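/- arXiv:1404.3086 — 3 statements merged into one kernel-verified Lean document; each statement's English description precedes it below -/
import Mathlib

section
/- Let g be a probability density on ℝ with finite second moment, g ∈ L¹(ℝ) ∩ C⁰(ℝ) and zero mean, and let ĝₙ(ξ) = ∏_{j=0}^{n−1} ĝ(ξ/2^j)^{2^j}. Then ĝₙ converges uniformly on every compact subset of ℝ to a continuous function ĝ_∞, which is the characteristic function of a probability measure g_∞; moreover g_∞ satisfies g_∞ = g ∗ (2g_∞(2·)) ∗ (2g_∞(2·)), so that g_∞ is a continuous function belonging to L¹(ℝ) and solves the fixed-point equation f = (2(f∗f)(2·))∗g. -/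
open MeasureTheory Real

/-- Fourier transform `ĥ(ξ) = ∫ h(x) e^{-iξx} dx`. -/
noncomputable def ft (h : ℝ → ℝ) (ξ : ℝ) : ℂ :=
  ∫ x : ℝ, (h x : ℂ) * Complex.exp (-(Complex.I * ξ * x))

/-- Convolution on `ℝ`: `(h₁ ∗ h₂)(x) = ∫ h₁(x-y) h₂(y) dy`. -/
noncomputable def conv (h₁ h₂ : ℝ → ℝ) (x : ℝ) : ℝ :=
  ∫ y : ℝ, h₁ (x - y) * h₂ y

lemma expkey (u : ℝ) : ‖Complex.exp (-(Complex.I * u)) - 1 + Complex.I * u‖ ≤ 3 * u ^ 2 := by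
  by_cases h : |u| ≤ 1
  · have h1 : ‖-(Complex.I * (u:ℂ))‖ = |u| := by simp
    have := Complex.norm_exp_sub_one_sub_id_le (x := -(Complex.I * u)) (by rw [h1]; exact h)
    rw [h1, sq_abs, sub_neg_eq_add] at this
    nlinarith [sq_nonneg u]
  · push Not at h
    have e : ‖Complex.exp (-(Complex.I * u))‖ = 1 := by
      rw [Complex.norm_exp]; simp
    have h2 : ‖Complex.exp (-(Complex.I * u)) - 1 + Complex.I * u‖ ≤ 1 + 1 + |u| := by
      refine (norm_add_le _ _).trans (add_le_add ((norm_sub_le _ _).trans ?_) (by simp))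
      simp [e]
    have : u ^ 2 = |u| ^ 2 := (sq_abs u).symm
    nlinarith

lemma ft_sub_one (g : ℝ → ℝ)
    (hg_nonneg : ∀ x, 0 ≤ g x)
    (hg_int : Integrable g)
    (hg_mass : ∫ x : ℝ, g x = 1)
    (hg_mom2 : Integrable (fun x => x ^ 2 * g x))
    (hg_mean : (∫ x : ℝ, x * g x) = 0) :
    ∃ C : ℝ, 0 ≤ C ∧ ∀ ξ, ‖ft g ξ - 1‖ ≤ C * ξ ^ 2 := by
  refine ⟨3 * ∫ x, x ^ 2 * g x, by
    have : 0 ≤ ∫ x, x ^ 2 * g x := integral_nonneg fun x => mul_nonneg (sq_nonneg x) (hg_nonneg x)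
    positivity, fun ξ => ?_⟩
  have hi1 : Integrable (fun x => x * g x) := by
    refine (hg_int.add hg_mom2).mono' (aestronglyMeasurable_id.mul hg_int.1) ?_
    filter_upwards with x
    simp only [Pi.add_apply, norm_mul, Real.norm_eq_abs, abs_of_nonneg (hg_nonneg x)]
    have : |x| ≤ 1 + x ^ 2 := by
      rw [← sq_abs]; nlinarith [sq_nonneg (|x| - 1), abs_nonneg x]
    nlinarith [hg_nonneg x, mul_le_mul_of_nonneg_right this (hg_nonneg x)]
  have hE : Integrable (fun x : ℝ => (g x : ℂ) * Complex.exp (-(Complex.I * ξ * x))) := by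
    refine hg_int.norm.mono' (hg_int.ofReal.1.mul (by fun_prop)) ?_
    filter_upwards with x
    rw [norm_mul, Complex.norm_exp]; simp
  have hkey : ft g ξ - 1 = ∫ x : ℝ, (g x : ℂ) *
      (Complex.exp (-(Complex.I * ((ξ * x : ℝ):ℂ))) - 1 + Complex.I * ((ξ * x : ℝ):ℂ)) := by
    have e2 : (∫ x : ℝ, (g x : ℂ)) = 1 := by rw [integral_complex_ofReal, hg_mass]; simp
    have e3 : (∫ x : ℝ, Complex.I * ξ * ((x * g x : ℝ) : ℂ)) = 0 := by
      rw [integral_const_mul, integral_complex_ofReal, hg_mean]; simp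
    have h3 : Integrable (fun x : ℝ => Complex.I * ξ * ((x * g x : ℝ) : ℂ)) :=
      hi1.ofReal.const_mul _
    have : ft g ξ - 1 = (∫ x : ℝ, (g x : ℂ) * Complex.exp (-(Complex.I * ξ * x)))
        - (∫ x : ℝ, (g x : ℂ)) + ∫ x : ℝ, Complex.I * ξ * ((x * g x : ℝ) : ℂ) := by
      rw [e2, e3, add_zero, ft]
    have hgc : Integrable (fun x : ℝ => (g x : ℂ)) := hg_int.ofReal
    rw [this, ← integral_sub hE hgc, ← integral_add (by exact hE.sub hgc) h3]
    congr 1; ext x; push_cast; ring_nf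
  rw [hkey, mul_assoc, ← integral_mul_const, ← integral_const_mul]
  refine norm_integral_le_of_norm_le ((hg_mom2.mul_const _).const_mul _) ?_
  filter_upwards with x
  rw [norm_mul, Complex.norm_real, Real.norm_eq_abs, abs_of_nonneg (hg_nonneg x)]
  have := mul_le_mul_of_nonneg_left (expkey (ξ * x)) (hg_nonneg x)
  linarith

lemma pow_sub_one_le (a : ℂ) (ha : ‖a‖ ≤ 1) (k : ℕ) : ‖a ^ k - 1‖ ≤ k * ‖a - 1‖ := by
  induction k with
  | zero => simp
  | succ k ih =>
    have : a ^ (k+1) - 1 = a * (a ^ k - 1) + (a - 1) := by ring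
    rw [this]
    refine (norm_add_le _ _).trans ?_
    rw [norm_mul]
    push_cast
    nlinarith [norm_nonneg (a^k - 1), norm_nonneg a]

lemma ft_integrand (g : ℝ → ℝ) (hg_int : Integrable g) (ξ : ℝ) :
    Integrable (fun x : ℝ => (g x : ℂ) * Complex.exp (-(Complex.I * ξ * x))) := by
  refine hg_int.norm.mono' (hg_int.ofReal.1.mul (by fun_prop)) ?_
  filter_upwards with x
  rw [norm_mul, Complex.norm_exp]; simp

lemma ft_cont (g : ℝ → ℝ) (hg_int : Integrable g) : Continuous (ft g) := by
  unfold ft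
  refine continuous_of_dominated (bound := fun x => ‖g x‖) (fun ξ => (ft_integrand g hg_int ξ).1) ?_
    hg_int.norm ?_
  · intro ξ
    filter_upwards with x
    rw [norm_mul, Complex.norm_exp]; simp
  · filter_upwards with x
    fun_prop

lemma ft_norm (g : ℝ → ℝ) (hg_nonneg : ∀ x, 0 ≤ g x) (hg_int : Integrable g)
    (hg_mass : ∫ x : ℝ, g x = 1) (ξ : ℝ) : ‖ft g ξ‖ ≤ 1 := by
  rw [← hg_mass]
  refine norm_integral_le_of_norm_le hg_int ?_
  filter_upwards with x
  rw [norm_mul, Complex.norm_exp]; simp [abs_of_nonneg (hg_nonneg x)]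

lemma ft_norm_lt (g : ℝ → ℝ) (hg_nonneg : ∀ x, 0 ≤ g x) (hg_int : Integrable g)
    (hg_cont : Continuous g)
    (hg_mass : ∫ x : ℝ, g x = 1) (ξ : ℝ) (hξ : ξ ≠ 0) : ‖ft g ξ‖ < 1 := by
  refine lt_of_le_of_ne (ft_norm g hg_nonneg hg_int hg_mass ξ) fun h1 => ?_
  set θ := Complex.arg (ft g ξ) with hθ
  have hpol : ft g ξ = Complex.exp (θ * Complex.I) := by
    have := Complex.norm_mul_exp_arg_mul_I (ft g ξ)
    rw [h1] at this; simpa using this.symm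
  have h2 : (∫ x : ℝ, (g x : ℂ) * Complex.exp (((-(ξ * x + θ) : ℝ) : ℂ) * Complex.I)) = 1 := by
    have : (∫ x : ℝ, (g x : ℂ) * Complex.exp (((-(ξ * x + θ) : ℝ) : ℂ) * Complex.I))
        = ft g ξ * Complex.exp (-(θ * Complex.I)) := by
      rw [ft, ← integral_mul_const]
      congr 1; ext x
      rw [mul_assoc, ← Complex.exp_add]; congr 2; push_cast; ring
    rw [this, hpol, ← Complex.exp_add]; simp
  have hci : Integrable (fun x => g x * Real.cos (ξ * x + θ)) := by
    refine hg_int.norm.mono' (hg_int.1.mul (by fun_prop)) ?_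
    filter_upwards with x
    rw [norm_mul]
    exact mul_le_of_le_one_right (norm_nonneg _) (Real.abs_cos_le_one _)
  have h3 : ∫ x, g x * Real.cos (ξ * x + θ) = 1 := by
    have hI : Integrable (fun x : ℝ => (g x : ℂ) * Complex.exp (((-(ξ * x + θ) : ℝ) : ℂ) * Complex.I)) := by
      refine hg_int.norm.mono' (hg_int.ofReal.1.mul (by fun_prop)) ?_
      filter_upwards with x
      rw [norm_mul, Complex.norm_exp_ofReal_mul_I]; simp
    have := congrArg Complex.re h2
    rw [show Complex.re = RCLike.re from rfl, ← integral_re hI] at this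
    rw [show RCLike.re (1:ℂ) = 1 from rfl] at this
    rw [← this]
    congr 1; ext x
    show _ = Complex.re _
    rw [Complex.re_ofReal_mul, Complex.exp_ofReal_mul_I_re, Real.cos_neg]
  have h4 : ∫ x, g x * (1 - Real.cos (ξ * x + θ)) = 0 := by
    simp_rw [mul_sub, mul_one]
    rw [integral_sub hg_int hci, h3, hg_mass]; simp
  have hnn : ∀ x, 0 ≤ g x * (1 - Real.cos (ξ * x + θ)) := fun x =>
    mul_nonneg (hg_nonneg x) (by linarith [Real.cos_le_one (ξ * x + θ)])
  have h5 : (fun x => g x * (1 - Real.cos (ξ * x + θ))) = 0 := by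
    have := (integral_eq_zero_iff_of_nonneg hnn (by
      simp_rw [mul_sub, mul_one]; exact hg_int.sub hci)).1 h4
    exact (Continuous.ae_eq_iff_eq volume (by fun_prop) (by fun_prop)).1 this
  obtain ⟨x0, hx0⟩ : ∃ x, 0 < g x := by
    by_contra hcon
    push Not at hcon
    have : ∀ x, g x = 0 := fun x => le_antisymm (hcon x) (hg_nonneg x)
    simp [this] at hg_mass
  have hev : ∀ᶠ x in nhds x0, 0 < g x := hg_cont.continuousAt.eventually (lt_mem_nhds hx0)
  obtain ⟨r, hr, hball⟩ := Metric.eventually_nhds_iff.1 hev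
  have hcos : ∀ x, 0 < g x → Real.cos (ξ * x + θ) = 1 := fun x hx => by
    have := congrFun h5 x
    simp only [Pi.zero_apply, mul_eq_zero, hx.ne', false_or] at this
    linarith
  set δ := min (r/2) (1/|ξ|) with hδ
  have hξ' : 0 < |ξ| := abs_pos.2 hξ
  have hδ0 : 0 < δ := by positivity
  have hc1 := hcos x0 hx0
  have hc2 := hcos (x0 + δ) (hball (by
    rw [dist_eq_norm]; simp [abs_of_pos hδ0]
    exact (min_le_left _ _).trans_lt (by linarith)))
  have hs1 : Real.sin (ξ * x0 + θ) = 0 := by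
    have := Real.sin_sq_add_cos_sq (ξ * x0 + θ)
    rw [hc1] at this
    simpa using this
  rw [show ξ * (x0 + δ) + θ = (ξ * x0 + θ) + ξ * δ by ring, Real.cos_add, hc1, hs1] at hc2
  have hb : |ξ * δ| ≤ 1 := by
    rw [abs_mul, abs_of_pos hδ0]
    calc |ξ| * δ ≤ |ξ| * (1/|ξ|) := by gcongr; exact min_le_right _ _
      _ = 1 := by field_simp
  rw [abs_le] at hb
  have := (Real.cos_eq_one_iff_of_lt_of_lt (x := ξ * δ) (by linarith [Real.pi_gt_three])
    (by linarith [Real.pi_gt_three])).1 (by linarith)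
  exact (mul_ne_zero hξ hδ0.ne') this

/-- partial products -/
noncomputable def PP (G : ℝ → ℂ) (n : ℕ) (ξ : ℝ) : ℂ :=
  ∏ j ∈ Finset.range n, (G (ξ / 2 ^ j)) ^ (2 ^ j : ℕ)

lemma PP_norm (G : ℝ → ℂ) (hG : ∀ ξ, ‖G ξ‖ ≤ 1) (n : ℕ) (ξ : ℝ) : ‖PP G n ξ‖ ≤ 1 := by
  unfold PP
  rw [norm_prod]
  refine Finset.prod_le_one (fun _ _ => norm_nonneg _) fun j _ => ?_
  rw [norm_pow]
  exact pow_le_one₀ (norm_nonneg _) (hG _)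

lemma PP_succ (G : ℝ → ℂ) (n : ℕ) (ξ : ℝ) : PP G (n+1) ξ = G ξ * (PP G n (ξ/2)) ^ 2 := by
  unfold PP
  rw [Finset.prod_range_succ', mul_comm, ← Finset.prod_pow]
  simp only [pow_zero, div_one, pow_one]
  congr 1
  refine Finset.prod_congr rfl fun j _ => ?_
  rw [← pow_mul, div_div, pow_succ' (2:ℝ) j, pow_succ (2:ℕ) j]

lemma PP_lim (G : ℝ → ℂ) (hG : ∀ ξ, ‖G ξ‖ ≤ 1) (C : ℝ) (hC : ∀ ξ, ‖G ξ - 1‖ ≤ C * ξ ^ 2) :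
    ∃ φ : ℝ → ℂ, ∀ n ξ, ‖PP G n ξ - φ ξ‖ ≤ 2 * C * ξ ^ 2 / 2 ^ n := by
  have hstep : ∀ ξ n, dist (PP G n ξ) (PP G (n+1) ξ) ≤ 2 * C * ξ ^ 2 / 2 / 2 ^ n := by
    intro ξ n
    rw [dist_comm, dist_eq_norm]
    have : PP G (n+1) ξ - PP G n ξ = PP G n ξ * ((G (ξ / 2 ^ n)) ^ (2 ^ n : ℕ) - 1) := by
      unfold PP; rw [Finset.prod_range_succ]; ring
    rw [this, norm_mul]
    calc _ ≤ 1 * (((2 ^ n : ℕ) : ℝ) * ‖G (ξ / 2 ^ n) - 1‖) := by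
          gcongr
          · exact PP_norm G hG n ξ
          · exact pow_sub_one_le _ (hG _) _
      _ ≤ 1 * (((2 ^ n : ℕ) : ℝ) * (C * (ξ / 2 ^ n) ^ 2)) := by gcongr; exact hC _
      _ = _ := by push_cast; field_simp
  have hc : ∀ ξ, ∃ z, Filter.Tendsto (fun n => PP G n ξ) Filter.atTop (nhds z) := fun ξ =>
    cauchySeq_tendsto_of_complete (cauchySeq_of_le_geometric_two (hstep ξ))
  choose φ hφ using hc
  refine ⟨φ, fun n ξ => ?_⟩
  rw [← dist_eq_norm]
  exact dist_le_of_le_geometric_two_of_tendsto (hstep ξ) (hφ ξ) n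

lemma PP_cont (G : ℝ → ℂ) (hG : Continuous G) (n : ℕ) : Continuous (PP G n) := by
  unfold PP; fun_prop

lemma lim_unif (G φ : ℝ → ℂ) (C : ℝ) (hC : 0 ≤ C)
    (hφ : ∀ n ξ, ‖PP G n ξ - φ ξ‖ ≤ C * ξ ^ 2 / 2 ^ n) (K : Set ℝ) (hK : IsCompact K) :
    TendstoUniformlyOn (PP G) φ Filter.atTop K := by
  obtain ⟨R, hR⟩ := hK.isBounded.exists_norm_le
  rw [Metric.tendstoUniformlyOn_iff]
  intro ε hε
  have ht : Filter.Tendsto (fun n : ℕ => C * R ^ 2 * (1/2:ℝ) ^ n) Filter.atTop (nhds 0) := by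
    simpa using (tendsto_pow_atTop_nhds_zero_of_lt_one (r := (1/2:ℝ)) (by norm_num)
      (by norm_num)).const_mul (C * R ^ 2)
  filter_upwards [ht.eventually (gt_mem_nhds hε)] with n hn ξ hξ
  rw [dist_comm, dist_eq_norm]
  refine (hφ n ξ).trans_lt (lt_of_le_of_lt ?_ hn)
  have : ξ ^ 2 ≤ R ^ 2 := by
    rw [← sq_abs]; exact pow_le_pow_left₀ (abs_nonneg _) (hR ξ hξ) 2
  calc C * ξ ^ 2 / 2 ^ n ≤ C * R ^ 2 / 2 ^ n := by gcongr
    _ = _ := by rw [one_div, inv_pow]; rfl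

lemma decay (G φ : ℝ → ℂ) (hG : Continuous G) (hG1 : ∀ ξ, ‖G ξ‖ ≤ 1)
    (hGlt : ∀ ξ, ξ ≠ 0 → ‖G ξ‖ < 1) (hφ1 : ∀ ξ, ‖φ ξ‖ ≤ 1)
    (hrec : ∀ ξ, φ ξ = G ξ * φ (ξ / 2) ^ 2) (hφm : Continuous φ) : Integrable φ := by
  obtain ⟨x, hx, hmax⟩ := (isCompact_Icc (a := (1:ℝ)) (b := 2)).exists_isMaxOn
    (by simp) (f := fun ξ => max ‖G ξ‖ ‖G (-ξ)‖) (by fun_prop)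
  set c := max (max ‖G x‖ ‖G (-x)‖) (1/2) with hc
  have hc0 : 0 < c := by positivity
  have hc1 : c < 1 := by
    refine max_lt (max_lt (hGlt _ ?_) (hGlt _ ?_)) (by norm_num)
    · linarith [hx.1]
    · linarith [hx.1]
  have hcb : ∀ ξ, 1 ≤ |ξ| → |ξ| ≤ 2 → ‖G ξ‖ ≤ c := by
    intro ξ h1 h2
    have := hmax (show |ξ| ∈ Set.Icc (1:ℝ) 2 from ⟨h1, h2⟩)
    simp only [Set.mem_ofPred_eq] at this
    refine le_trans ?_ (this.trans (le_max_left _ _))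
    rcases abs_choice ξ with h | h <;> rw [h]
    · exact le_max_left _ _
    · rw [neg_neg]; exact le_max_right _ _
  set a := -Real.log c / 2 with ha
  have ha0 : 0 < a := by have := Real.log_neg hc0 hc1; linarith
  have hca : c = Real.exp (-(2 * a)) := by
    rw [ha]; ring_nf; rw [Real.exp_log hc0]
  have hind : ∀ k : ℕ, ∀ ξ : ℝ, 1 ≤ |ξ| → |ξ| ≤ 2 ^ (k+1) → ‖φ ξ‖ ≤ Real.exp (-(a * |ξ|)) := by
    have hr : ∀ ξ, ‖φ ξ‖ = ‖G ξ‖ * ‖φ (ξ / 2)‖ ^ 2 := fun ξ => by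
      rw [hrec ξ, norm_mul, norm_pow]
    have base : ∀ ξ : ℝ, 1 ≤ |ξ| → |ξ| ≤ 2 → ‖φ ξ‖ ≤ Real.exp (-(a * |ξ|)) := by
      intro ξ h1 h2
      rw [hr]
      calc _ ≤ c * 1 := by
            gcongr
            · exact hcb ξ h1 h2
            · exact pow_le_one₀ (norm_nonneg _) (hφ1 _)
        _ = Real.exp (-(2 * a)) := by rw [mul_one, hca]
        _ ≤ _ := by rw [Real.exp_le_exp]; nlinarith
    intro k
    induction k with
    | zero => intro ξ h1 h2; exact base ξ h1 (by simpa using h2)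
    | succ k ih =>
      intro ξ h1 h2
      by_cases h : |ξ| ≤ 2
      · exact base ξ h1 h
      · push Not at h
        have e : |ξ / 2| = |ξ| / 2 := by rw [abs_div]; simp
        have := ih (ξ / 2) (by rw [e]; linarith) (by rw [e]; rw [pow_succ] at h2; linarith)
        rw [hr]
        calc _ ≤ 1 * (Real.exp (-(a * |ξ / 2|))) ^ 2 := by
              gcongr
              exact hG1 _
          _ = _ := by rw [one_mul, ← Real.exp_nat_mul, e]; congr 1; push_cast; ring
  have hall : ∀ ξ, ‖φ ξ‖ ≤ Real.exp a * Real.exp (-(a * |ξ|)) := by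
    intro ξ
    by_cases h : 1 ≤ |ξ|
    · obtain ⟨k, hk⟩ := pow_unbounded_of_one_lt |ξ| (one_lt_two)
      refine (hind k ξ h (hk.le.trans (pow_le_pow_right₀ one_le_two (by simp)))).trans ?_
      exact le_mul_of_one_le_left (Real.exp_nonneg _) (Real.one_le_exp ha0.le)
    · push Not at h
      refine (hφ1 ξ).trans ?_
      rw [← Real.exp_add]
      apply Real.one_le_exp
      nlinarith
  set b := min 1 (a ^ 2 / 2) with hb
  have hb0 : 0 < b := by positivity
  refine (integrable_inv_one_add_sq.const_mul (Real.exp a * b⁻¹)).mono' hφm.aestronglyMeasurable ?_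
  filter_upwards with ξ
  refine (hall ξ).trans ?_
  rw [mul_assoc]
  gcongr
  rw [Real.exp_neg, ← mul_inv]
  apply inv_anti₀ (by positivity)
  have := Real.quadratic_le_exp_of_nonneg (x := a * |ξ|) (by positivity)
  have h1 : b ≤ 1 := min_le_left _ _
  have h2 : b ≤ a ^ 2 / 2 := min_le_right _ _
  have h3 : (a * |ξ|) ^ 2 = a ^ 2 * ξ ^ 2 := by rw [mul_pow, sq_abs]
  rw [h3] at this
  have : 0 ≤ a * |ξ| := by positivity
  nlinarith [mul_le_mul_of_nonneg_right h2 (sq_nonneg ξ)]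

open scoped ComplexOrder FourierTransform in
lemma gauss_ft (ε : ℝ) (hε : 0 < ε) (s : ℝ) :
    ∫ t : ℝ, Complex.exp (Complex.I * s * t) * ((Real.exp (-ε * t ^ 2) : ℝ) : ℂ)
      = ((√(π / ε) * Real.exp (-(1 / (4 * ε)) * s ^ 2) : ℝ) : ℂ) := by
  have := fourierIntegral_gaussian (b := (ε : ℂ)) (by simpa using hε) s
  have e : ((√(π / ε) : ℝ) : ℂ) = (π / ε : ℂ) ^ (1 / 2 : ℂ) := by
    rw [Real.sqrt_eq_rpow, Complex.ofReal_cpow (by positivity)]; push_cast; rfl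
  rw [Complex.ofReal_mul, e]
  push_cast
  rw [this]
  congr 2
  field_simp

lemma char_ft (g : ℝ → ℝ) (hg_nonneg : ∀ x, 0 ≤ g x) (hg_int : Integrable g)
    (hg_mass : ∫ x : ℝ, g x = 1) :
    ∃ μ : Measure ℝ, IsProbabilityMeasure μ ∧ ∀ t, ft g t = charFun μ t := by
  set μ0 : Measure ℝ := volume.withDensity (fun x => ENNReal.ofReal (g x)) with hμ0
  have hp : IsProbabilityMeasure μ0 := by
    constructor
    rw [hμ0, withDensity_apply _ MeasurableSet.univ, Measure.restrict_univ,
      ← ofReal_integral_eq_lintegral_ofReal hg_int (Filter.Eventually.of_forall hg_nonneg), hg_mass]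
    simp
  refine ⟨μ0.map ((-1 : ℝ) * ·), Measure.isProbabilityMeasure_map (by fun_prop), fun t => ?_⟩
  rw [charFun_map_mul, charFun_apply_real, hμ0,
    integral_withDensity_eq_integral_toReal_smul₀ (hg_int.1.aemeasurable.ennreal_ofReal)
      (by simp), ft]
  congr 1; ext x
  rw [ENNReal.toReal_ofReal (hg_nonneg x), Complex.real_smul]
  congr 2; push_cast; ring

lemma char_PP (G : ℝ → ℂ) (h : ∃ μ : Measure ℝ, IsProbabilityMeasure μ ∧ ∀ t, G t = charFun μ t)
    (n : ℕ) :
    ∃ μ : Measure ℝ, IsProbabilityMeasure μ ∧ ∀ t, PP G n t = charFun μ t := by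
  obtain ⟨ν, hν, hνG⟩ := h
  induction n with
  | zero => exact ⟨Measure.dirac 0, inferInstance, fun t => by simp [PP, charFun_dirac]⟩
  | succ n ih =>
    obtain ⟨μ, hμ, h⟩ := ih
    set μ' := μ.map ((1/2 : ℝ) * ·) with hμ'
    have : IsProbabilityMeasure μ' := Measure.isProbabilityMeasure_map (by fun_prop)
    refine ⟨Measure.conv ν (Measure.conv μ' μ'), inferInstance, fun t => ?_⟩
    rw [charFun_conv, charFun_conv, PP_succ, h, hνG, hμ', charFun_map_mul, sq]
    congr 3 <;> ring_nf

open scoped ComplexOrder in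
lemma char_pos (μ : Measure ℝ) [IsProbabilityMeasure μ] (ε : ℝ) (hε : 0 < ε) (x : ℝ) :
    0 ≤ ∫ t : ℝ, charFun μ t * Complex.exp (Complex.I * t * x) *
      ((Real.exp (-ε * t ^ 2) : ℝ) : ℂ) := by
  have hi : Integrable (fun p : ℝ × ℝ => Complex.exp (Complex.I * ((x + p.2 : ℝ) : ℂ) * p.1) *
      ((Real.exp (-ε * p.1 ^ 2) : ℝ) : ℂ)) (volume.prod μ) := by
    refine ((integrable_exp_neg_mul_sq hε).comp_fst μ).mono' (by fun_prop) ?_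
    filter_upwards with p
    rw [norm_mul, Complex.norm_exp, Complex.norm_real, Real.norm_eq_abs, Real.abs_exp]
    simp
  have e : (∫ t : ℝ, charFun μ t * Complex.exp (Complex.I * t * x) *
      ((Real.exp (-ε * t ^ 2) : ℝ) : ℂ)) = ∫ t : ℝ, ∫ y, Complex.exp (Complex.I * ((x + y : ℝ) : ℂ) * t) *
      ((Real.exp (-ε * t ^ 2) : ℝ) : ℂ) ∂μ := by
    congr 1; ext t
    rw [charFun_apply_real, ← integral_mul_const, ← integral_mul_const]
    congr 1; ext y
    rw [← Complex.exp_add]; congr 2; push_cast; ring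
  rw [e, integral_integral_swap hi]
  simp_rw [gauss_ft ε hε]
  rw [integral_complex_ofReal]
  exact Complex.zero_le_real.2 (integral_nonneg fun y => by positivity)

open scoped ComplexOrder in
lemma lim_pos (ψ : ℕ → ℝ → ℂ) (φ : ℝ → ℂ) (hφi : Integrable φ)
    (hψ : ∀ n, ∃ μ : Measure ℝ, IsProbabilityMeasure μ ∧ ∀ t, ψ n t = charFun μ t)
    (hlim : ∀ t, Filter.Tendsto (fun n => ψ n t) Filter.atTop (nhds (φ t))) (x : ℝ) :
    0 ≤ ∫ t : ℝ, φ t * Complex.exp (Complex.I * t * x) := by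
  have hne : ∀ t : ℝ, ‖Complex.exp (Complex.I * t * x)‖ = 1 := fun t => by
    rw [Complex.norm_exp]; simp
  have step1 : ∀ ε : ℝ, 0 < ε → 0 ≤ ∫ t : ℝ, φ t * Complex.exp (Complex.I * t * x) *
      ((Real.exp (-ε * t ^ 2) : ℝ) : ℂ) := by
    intro ε hε
    refine ge_of_tendsto' (x := Filter.atTop) (f := fun n => ∫ t : ℝ, ψ n t *
      Complex.exp (Complex.I * t * x) * ((Real.exp (-ε * t ^ 2) : ℝ) : ℂ)) ?_ ?_
    · refine tendsto_integral_of_dominated_convergence (fun t => Real.exp (-ε * t ^ 2)) ?_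
        (integrable_exp_neg_mul_sq hε) ?_ ?_
      · intro n
        obtain ⟨μ, hμ, h⟩ := hψ n
        simp_rw [h]
        exact ((measurable_charFun.mul (by fun_prop)).mul (by fun_prop)).aestronglyMeasurable
      · intro n
        obtain ⟨μ, hμ, h⟩ := hψ n
        filter_upwards with t
        rw [norm_mul, norm_mul, hne, h, Complex.norm_real, Real.norm_eq_abs, Real.abs_exp, mul_one]
        exact mul_le_of_le_one_left (Real.exp_nonneg _) (norm_charFun_le_one t)
      · filter_upwards with t
        exact ((hlim t).mul_const _).mul_const _
    · intro n
      obtain ⟨μ, hμ, h⟩ := hψ n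
      simp_rw [h]
      exact char_pos μ ε hε x
  refine ge_of_tendsto' (x := Filter.atTop) (f := fun n : ℕ => ∫ t : ℝ, φ t *
      Complex.exp (Complex.I * t * x) * ((Real.exp (-(1/((n:ℝ)+1)) * t ^ 2) : ℝ) : ℂ)) ?_
      (fun n => step1 _ (by positivity))
  refine tendsto_integral_of_dominated_convergence (fun t => ‖φ t‖) ?_ hφi.norm ?_ ?_
  · intro n
    exact (hφi.1.mul (by fun_prop)).mul (by fun_prop)
  · intro n
    filter_upwards with t
    rw [norm_mul, norm_mul, hne, Complex.norm_real, Real.norm_eq_abs, Real.abs_exp, mul_one]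
    refine mul_le_of_le_one_right (norm_nonneg _) (Real.exp_le_one_iff.2 ?_)
    have : 0 ≤ 1/((n:ℝ)+1) * t ^ 2 := by positivity
    linarith
  · filter_upwards with t
    have h0 : Filter.Tendsto (fun n : ℕ => Real.exp (-(1/((n:ℝ)+1)) * t ^ 2)) Filter.atTop (nhds 1) := by
      have := ((tendsto_one_div_add_atTop_nhds_zero_nat (𝕜 := ℝ)).neg.mul_const (t^2)).rexp
      simpa using this
    have h1 : Filter.Tendsto (fun n : ℕ => ((Real.exp (-(1/((n:ℝ)+1)) * t ^ 2) : ℝ) : ℂ))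
        Filter.atTop (nhds ((1:ℝ):ℂ)) := (Complex.continuous_ofReal.tendsto 1).comp h0
    simpa using h1.const_mul (φ t * Complex.exp (Complex.I * t * x))

lemma inv_cont (φ : ℝ → ℂ) (hφi : Integrable φ) :
    Continuous (fun x : ℝ => ∫ t : ℝ, φ t * Complex.exp (Complex.I * t * x)) := by
  refine continuous_of_dominated (bound := fun t => ‖φ t‖)
    (fun x => hφi.1.mul (by fun_prop)) ?_ hφi.norm ?_
  · intro x
    filter_upwards with t
    rw [norm_mul, Complex.norm_exp]; simp
  · filter_upwards with x
    fun_prop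

lemma F_int (φ : ℝ → ℂ) (F : ℝ → ℝ) (hφi : Integrable φ) (hφ1 : ∀ t, ‖φ t‖ ≤ 1)
    (hF0 : ∀ x, 0 ≤ F x) (hFc : Continuous F) (hFb : ∃ B, ∀ x, F x ≤ B)
    (hF : ∀ x, (F x : ℂ) = (1 / (2 * π) : ℝ) * ∫ t : ℝ, φ t * Complex.exp (Complex.I * t * x)) :
    Integrable F := by
  obtain ⟨B, hB⟩ := hFb
  have hFe : ∀ ε : ℝ, 0 < ε → Integrable (fun x => F x * Real.exp (-ε * x ^ 2)) := by
    intro ε hε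
    refine ((integrable_exp_neg_mul_sq hε).const_mul B).mono' (by fun_prop) ?_
    filter_upwards with x
    rw [Real.norm_eq_abs, abs_of_nonneg (mul_nonneg (hF0 x) (Real.exp_nonneg _))]
    gcongr
    exact hB x
  have key : ∀ ε : ℝ, 0 < ε → ∫ x, F x * Real.exp (-ε * x ^ 2) ≤ 1 := by
    intro ε hε
    have hi : Integrable (fun p : ℝ × ℝ => φ p.2 * (Complex.exp (Complex.I * p.2 * p.1) *
      ((Real.exp (-ε * p.1 ^ 2) : ℝ) : ℂ))) (volume.prod volume) := by
      have h1 : Integrable (fun p : ℝ × ℝ => Real.exp (-ε * p.1 ^ 2) * ‖φ p.2‖) (volume.prod volume) :=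
        (integrable_exp_neg_mul_sq hε).mul_prod hφi.norm
      refine h1.mono' ?_ ?_
      · exact (hφi.1.comp_snd).mul (by fun_prop)
      · filter_upwards with p
        rw [norm_mul, norm_mul, Complex.norm_exp, Complex.norm_real, Real.norm_eq_abs, Real.abs_exp]
        simp [mul_comm]
    have e : ((∫ x, F x * Real.exp (-ε * x ^ 2) : ℝ) : ℂ) = (1 / (2 * π) : ℝ) *
        ∫ t : ℝ, φ t * ((√(π / ε) * Real.exp (-(1 / (4 * ε)) * t ^ 2) : ℝ) : ℂ) := by
      rw [← integral_complex_ofReal]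
      have : ∀ x : ℝ, ((F x * Real.exp (-ε * x ^ 2) : ℝ) : ℂ) = (1 / (2 * π) : ℝ) *
          ∫ t : ℝ, φ t * (Complex.exp (Complex.I * t * x) * ((Real.exp (-ε * x ^ 2) : ℝ) : ℂ)) := by
        intro x
        rw [Complex.ofReal_mul, hF, mul_assoc, ← integral_mul_const]
        simp_rw [mul_assoc]
      simp_rw [this]
      rw [integral_const_mul, integral_integral_swap hi]
      congr 2; ext t
      rw [integral_const_mul, gauss_ft ε hε]
    have hb : ‖((∫ x, F x * Real.exp (-ε * x ^ 2) : ℝ) : ℂ)‖ ≤ 1 := by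
      rw [e, norm_mul]
      have h4 : 0 < 1 / (4 * ε) := by positivity
      have : ‖∫ t : ℝ, φ t * ((√(π / ε) * Real.exp (-(1 / (4 * ε)) * t ^ 2) : ℝ) : ℂ)‖ ≤
          ∫ t : ℝ, √(π / ε) * Real.exp (-(1 / (4 * ε)) * t ^ 2) := by
        refine norm_integral_le_of_norm_le ((integrable_exp_neg_mul_sq h4).const_mul _) ?_
        filter_upwards with t
        rw [norm_mul, Complex.norm_real, Real.norm_eq_abs, abs_of_nonneg (by positivity)]
        exact mul_le_of_le_one_left (by positivity) (hφ1 t)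
      rw [integral_const_mul, integral_gaussian, ← Real.sqrt_mul (by positivity),
        show π / ε * (π / (1 / (4 * ε))) = (2 * π) ^ 2 by field_simp; norm_num,
        Real.sqrt_sq (by positivity)] at this
      rw [Complex.norm_real, Real.norm_eq_abs, abs_of_pos (by positivity)]
      calc _ ≤ 1 / (2 * π) * (2 * π) := by gcongr
        _ = 1 := by field_simp
    rw [Complex.norm_real, Real.norm_eq_abs] at hb
    exact (le_abs_self _).trans hb
  refine integrable_of_intervalIntegral_norm_bounded (l := Filter.atTop)
    (a := fun n : ℕ => -((n:ℝ)+1)) (b := fun n : ℕ => (n:ℝ)+1) (Real.exp 1) ?_ ?_ ?_ ?_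
  · intro n; exact (hFc.integrableOn_Icc).mono_set Set.Ioc_subset_Icc_self
  · exact Filter.tendsto_neg_atTop_atBot.comp
      (Filter.tendsto_atTop_add_const_right _ _ tendsto_natCast_atTop_atTop)
  · exact Filter.tendsto_atTop_add_const_right _ _ tendsto_natCast_atTop_atTop
  · filter_upwards with n
    set R : ℝ := (n:ℝ)+1 with hR
    have hR0 : 0 < R := by positivity
    rw [intervalIntegral.integral_of_le (by linarith)]
    have hε : 0 < 1 / R ^ 2 := by positivity
    calc ∫ x in Set.Ioc (-R) R, ‖F x‖ ≤
        ∫ x in Set.Ioc (-R) R, Real.exp 1 * (F x * Real.exp (-(1 / R^2) * x ^ 2)) := by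
          refine setIntegral_mono_on ?_ ?_ measurableSet_Ioc ?_
          · exact (hFc.norm.integrableOn_Icc).mono_set Set.Ioc_subset_Icc_self
          · exact ((hFe _ hε).const_mul _).integrableOn
          · intro x hx
            rw [Real.norm_eq_abs, abs_of_nonneg (hF0 x), mul_left_comm, ← Real.exp_add]
            refine le_mul_of_one_le_right (hF0 x) (Real.one_le_exp ?_)
            have : x ^ 2 ≤ R ^ 2 := sq_le_sq' hx.1.le hx.2
            have : x ^ 2 / R ^ 2 ≤ 1 := by rw [div_le_one (by positivity)]; exact this
            have e : -(1 / R^2) * x ^ 2 = - (x ^ 2 / R ^ 2) := by ring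
            rw [e]; linarith
      _ ≤ ∫ x, Real.exp 1 * (F x * Real.exp (-(1 / R^2) * x ^ 2)) := by
          refine setIntegral_le_integral ((hFe _ hε).const_mul _) ?_
          filter_upwards with x
          have := hF0 x
          show 0 ≤ _
          positivity
      _ ≤ Real.exp 1 := by
          rw [integral_const_mul]
          exact mul_le_of_le_one_right (Real.exp_nonneg _) (key _ hε)

open scoped FourierTransform in
lemma ft_F (φ : ℝ → ℂ) (F : ℝ → ℝ) (hφi : Integrable φ) (hφc : Continuous φ)
    (hFi : Integrable F)
    (hF : ∀ x, (F x : ℂ) = (1 / (2 * π) : ℝ) * ∫ t : ℝ, φ t * Complex.exp (Complex.I * t * x)) 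
    (ξ : ℝ) : ft F ξ = φ ξ := by
  have hpi : (2 * π) ≠ 0 := by positivity
  set ψ : ℝ → ℂ := fun η => φ ((2 * π) * η) with hψ
  have h1 : 𝓕⁻ ψ = fun x => (F x : ℂ) := by
    ext x
    rw [Real.fourierInv_eq', hF]
    have := Measure.integral_comp_mul_left (fun t => φ t * Complex.exp (Complex.I * t * x)) (2 * π)
    rw [abs_of_pos (by positivity), Complex.real_smul, ← one_div] at this
    rw [← this]
    congr 1; ext η
    simp only [hψ, smul_eq_mul, RCLike.inner_apply, conj_trivial]
    rw [mul_comm]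
    congr 2; push_cast; ring
  have hψi : Integrable ψ := hφi.comp_mul_left' hpi
  have h2 := Continuous.fourierInv_fourier_eq (f := ψ)
  have hF' : Integrable (𝓕⁻ ψ) := by rw [h1]; exact hFi.ofReal
  have hFψ : Integrable (𝓕 ψ) := by
    have : 𝓕 ψ = fun x => 𝓕⁻ ψ (-x) := by
      ext x; rw [Real.fourierInv_eq_fourier_neg]; simp
    rw [this]; exact hF'.comp_neg
  have h3 := Continuous.fourier_fourierInv_eq (f := ψ) (by fun_prop) hψi hFψ
  have h4 := congrFun h3 (ξ / (2 * π))
  rw [h1, Real.fourier_eq'] at h4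
  simp only [hψ] at h4
  rw [mul_div_cancel₀ _ hpi] at h4
  rw [← h4, ft]
  congr 1; ext x
  simp only [smul_eq_mul, RCLike.inner_apply, conj_trivial]
  rw [mul_comm]
  congr 2
  have : (π : ℂ) ≠ 0 := by exact_mod_cast Real.pi_ne_zero
  push_cast; field_simp

lemma conv_inv (k h : ℝ → ℝ) (ψ : ℝ → ℂ) (c : ℂ) (hh : Integrable h) (hψ : Integrable ψ)
    (hk : ∀ x, (k x : ℂ) = c * ∫ t : ℝ, ψ t * Complex.exp (Complex.I * t * x)) (x : ℝ) :
    (conv k h x : ℂ) = c * ∫ t : ℝ, ψ t * ft h t * Complex.exp (Complex.I * t * x) := by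
  have hi : Integrable (fun p : ℝ × ℝ => ψ p.2 * Complex.exp (Complex.I * p.2 * ((x - p.1 : ℝ) : ℂ))
      * (h p.1 : ℂ)) (volume.prod volume) := by
    have h1 : Integrable (fun p : ℝ × ℝ => ‖h p.1‖ * ‖ψ p.2‖) (volume.prod volume) :=
      hh.norm.mul_prod hψ.norm
    have hhc : AEStronglyMeasurable (fun x : ℝ => (h x : ℂ)) volume := hh.ofReal.1
    refine h1.mono' ((hψ.1.comp_snd.mul (by fun_prop)).mul hhc.comp_fst) ?_
    filter_upwards with p
    rw [norm_mul, norm_mul, Complex.norm_exp, Complex.norm_real]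
    simp [mul_comm]
  rw [conv, ← integral_complex_ofReal]
  have : ∀ y : ℝ, ((k (x - y) * h y : ℝ) : ℂ) = c * ∫ t : ℝ,
      ψ t * Complex.exp (Complex.I * t * ((x - y : ℝ) : ℂ)) * (h y : ℂ) := by
    intro y
    rw [Complex.ofReal_mul, hk, mul_assoc, integral_mul_const]
  simp_rw [this]
  rw [integral_const_mul, integral_integral_swap hi]
  congr 2; ext t
  rw [ft, mul_assoc, ← integral_mul_const, ← integral_const_mul]
  congr 1; ext y
  rw [mul_assoc, mul_assoc, mul_comm _ (h y : ℂ), mul_assoc, ← Complex.exp_add]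
  congr 3; push_cast; ring

lemma fixed2 (F g : ℝ → ℝ) (hFi : Integrable F) (hFc : Continuous F) (B : ℝ)
    (hB : ∀ x, ‖F x‖ ≤ B) (hg : Integrable g) (hgc : Continuous g) (x : ℝ) :
    conv g (conv (fun y => 2 * F (2 * y)) (fun y => 2 * F (2 * y))) x =
      ∫ x' : ℝ, ∫ y : ℝ, F x' * F (x' + y) * g (x - x' - y / 2) := by
  have hGi : Integrable (fun y => 2 * F (2 * y)) := (hFi.comp_mul_left' two_ne_zero).const_mul 2
  have hi : Integrable (fun p : ℝ × ℝ => g (x - p.1) * ((2 * F (2 * (p.1 - p.2))) *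
      (2 * F (2 * p.2)))) (volume.prod volume) := by
    have h1 : Integrable (fun p : ℝ × ℝ => (2 * B) * (‖g (x - p.1)‖ * ‖2 * F (2 * p.2)‖))
        (volume.prod volume) :=
      ((hg.comp_sub_left x).norm.mul_prod hGi.norm).const_mul _
    refine h1.mono' (Continuous.aestronglyMeasurable (by fun_prop)) ?_
    filter_upwards with p
    rw [norm_mul, norm_mul, norm_mul 2 (F (2 * (p.1 - p.2)))]
    have := hB (2 * (p.1 - p.2))
    calc _ ≤ ‖g (x - p.1)‖ * (‖(2:ℝ)‖ * B * ‖2 * F (2 * p.2)‖) := by gcongr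
      _ = _ := by simp; ring
  unfold conv
  simp_rw [← integral_const_mul]
  rw [integral_integral_swap hi]
  have hs := Measure.integral_comp_div (fun b => ∫ v : ℝ, g (x - v) * ((2 * F (2 * (v - b))) *
      (2 * F (2 * b)))) 2
  simp only [abs_two, smul_eq_mul] at hs
  have hh : ∀ x' : ℝ, (∫ v : ℝ, g (x - v) * ((2 * F (2 * (v - x'/2))) * (2 * F (2 * (x'/2))))) =
      2 * ∫ y : ℝ, F x' * F (x' + y) * g (x - x' - y / 2) := by
    intro x'
    have h1 := Measure.integral_comp_div (fun w => F x' * F (x' + 2 * w) * g (x - x' - w)) 2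
    simp only [abs_two, smul_eq_mul] at h1
    have h2 := integral_add_left_eq_self (μ := (volume : Measure ℝ))
      (fun v => g (x - v) * ((2 * F (2 * (v - x'/2))) * (2 * F (2 * (x'/2))))) x'
    rw [← h2]
    have h3 : (fun y : ℝ => F x' * F (x' + y) * g (x - x' - y / 2)) =
        fun y => F x' * F (x' + 2 * (y / 2)) * g (x - x' - y / 2) := by
      ext y; congr 3; ring
    rw [h3, h1, ← mul_assoc, ← integral_const_mul]
    congr 1; ext w
    rw [show x - (x' + w) = x - x' - w by ring, show 2 * (x' + w - x' / 2) = x' + 2 * w by ring,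
      show 2 * (x' / 2) = x' by ring]
    ring
  simp_rw [hh] at hs
  rw [integral_const_mul] at hs
  linarith

/-- The partial products `ĝₙ(ξ) = ∏_{j=0}^{n-1} ĝ(ξ/2^j)^(2^j)` converge
uniformly on every compact set to a continuous function which is the characteristic function
(Fourier transform) of a probability measure `g_∞`; moreover `g_∞` has a continuous density
in `L¹(ℝ)` which satisfies `g_∞ = g ∗ (2g_∞(2·)) ∗ (2g_∞(2·))`, i.e. `g_∞` solves the
fixed-point equation `f = (2(f∗f)(2·))∗g`. -/
theorem stmt_2 (g : ℝ → ℝ)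
    (hg_nonneg : ∀ x, 0 ≤ g x)
    (hg_int : Integrable g)
    (hg_cont : Continuous g)
    (hg_mass : ∫ x : ℝ, g x = 1)
    (hg_mom2 : Integrable (fun x => x ^ 2 * g x))
    (hg_mean : (∫ x : ℝ, x * g x) = 0) :
    ∃ ginf : ℝ → ℝ,
      Continuous ginf ∧ Integrable ginf ∧ (∀ x, 0 ≤ ginf x) ∧ (∫ x : ℝ, ginf x = 1) ∧
      Continuous (fun ξ => ft ginf ξ) ∧
      (∀ K : Set ℝ, IsCompact K →
        TendstoUniformlyOn
          (fun (n : ℕ) (ξ : ℝ) => ∏ j ∈ Finset.range n, (ft g (ξ / 2 ^ j)) ^ (2 ^ j : ℕ))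
          (fun ξ => ft ginf ξ) Filter.atTop K) ∧
      (∀ x : ℝ, ginf x =
        conv g (conv (fun y => 2 * ginf (2 * y)) (fun y => 2 * ginf (2 * y))) x) ∧
      (∀ x : ℝ, ginf x = ∫ x' : ℝ, ∫ y : ℝ, ginf x' * ginf (x' + y) * g (x - x' - y / 2)) := by
  obtain ⟨C, hC0, hC⟩ := ft_sub_one g hg_nonneg hg_int hg_mass hg_mom2 hg_mean
  have hG1 := ft_norm g hg_nonneg hg_int hg_mass
  have hGc := ft_cont g hg_int
  obtain ⟨φ, hφ⟩ := PP_lim (ft g) hG1 C hC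
  have hunif := lim_unif (ft g) φ (2 * C) (by positivity) hφ
  have hlim : ∀ t, Filter.Tendsto (fun n => PP (ft g) n t) Filter.atTop (nhds (φ t)) := fun t =>
    (hunif {t} isCompact_singleton).tendsto_at rfl
  have hφc : Continuous φ := by
    have : TendstoLocallyUniformly (PP (ft g)) φ Filter.atTop := by
      rw [tendstoLocallyUniformly_iff_forall_isCompact]
      exact hunif
    exact this.continuous (Filter.Frequently.of_forall fun n => PP_cont _ hGc n)
  have hφ1 : ∀ t, ‖φ t‖ ≤ 1 := fun t =>
    le_of_tendsto' (hlim t).norm fun n => PP_norm _ hG1 n t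
  have hrec : ∀ ξ, φ ξ = ft g ξ * φ (ξ / 2) ^ 2 := by
    intro ξ
    refine tendsto_nhds_unique ((Filter.tendsto_add_atTop_iff_nat 1).2 (hlim ξ)) ?_
    simp_rw [PP_succ]
    exact ((hlim (ξ / 2)).pow 2).const_mul _
  have hφi : Integrable φ := decay (ft g) φ hGc hG1
    (fun ξ h => ft_norm_lt g hg_nonneg hg_int hg_cont hg_mass ξ h) hφ1 hrec hφc
  have hφ0 : φ 0 = 1 := by
    have h := hφ 0 0
    simp [PP] at h
    exact (sub_eq_zero.1 h).symm
  have hpos := lim_pos (PP (ft g)) φ hφi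
    (char_PP _ (char_ft g hg_nonneg hg_int hg_mass)) hlim
  set F : ℝ → ℝ := fun x => (1 / (2 * π)) * (∫ t : ℝ, φ t * Complex.exp (Complex.I * t * x)).re
    with hFdef
  have hF : ∀ x, (F x : ℂ) = (1 / (2 * π) : ℝ) * ∫ t : ℝ, φ t * Complex.exp (Complex.I * t * x) := by
    intro x
    rw [hFdef]
    simp only [Complex.ofReal_mul]
    congr 1
    apply Complex.ext
    · simp
    · simpa using (Complex.le_def.1 (hpos x)).2
  have hF0 : ∀ x, 0 ≤ F x := fun x =>
    mul_nonneg (by positivity) (by simpa using (Complex.le_def.1 (hpos x)).1)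
  have hFc : Continuous F := (Complex.continuous_re.comp (inv_cont φ hφi)).const_mul _
  have hFb : ∀ x, ‖F x‖ ≤ (1 / (2 * π)) * ∫ t, ‖φ t‖ := by
    intro x
    rw [← Complex.norm_real, hF, norm_mul, Complex.norm_real, Real.norm_eq_abs,
      abs_of_pos (by positivity)]
    gcongr
    refine norm_integral_le_of_norm_le hφi.norm ?_
    filter_upwards with t
    rw [norm_mul, Complex.norm_exp]; simp
  have hFi : Integrable F := F_int φ F hφi hφ1 hF0 hFc
    ⟨_, fun x => (le_abs_self _).trans (hFb x)⟩ hF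
  have hft : ft F = φ := funext (ft_F φ F hφi hφc hFi hF)
  have hfix : ∀ x, F x = conv g (conv (fun y => 2 * F (2 * y)) (fun y => 2 * F (2 * y))) x := by
    have hφ2i : Integrable (fun t => φ (t / 2)) := hφi.comp_div two_ne_zero
    have hGi : Integrable (fun y => 2 * F (2 * y)) := (hFi.comp_mul_left' two_ne_zero).const_mul 2
    have hG : ∀ x : ℝ, ((2 * F (2 * x) : ℝ) : ℂ) = ((1 / (2 * π) : ℝ) : ℂ) *
        ∫ t : ℝ, φ (t / 2) * Complex.exp (Complex.I * t * x) := by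
      intro x
      have := Measure.integral_comp_div
        (fun t => φ t * Complex.exp (Complex.I * t * ((2 * x : ℝ) : ℂ))) 2
      rw [abs_two, Complex.real_smul] at this
      rw [Complex.ofReal_mul, hF, mul_left_comm, ← this]
      congr 2; ext t; congr 2; push_cast; ring
    have hftG : ∀ ξ, ft (fun y => 2 * F (2 * y)) ξ = φ (ξ / 2) :=
      ft_F (fun t => φ (t / 2)) _ hφ2i (by fun_prop) hGi hG
    have hm := conv_inv _ _ (fun t => φ (t / 2)) _ hGi hφ2i hG
    simp_rw [hftG] at hm
    have hsqi : Integrable (fun t => φ (t / 2) * φ (t / 2)) := by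
      refine hφ2i.norm.mono' (Continuous.aestronglyMeasurable (by fun_prop)) ?_
      filter_upwards with t
      rw [norm_mul]
      exact mul_le_of_le_one_left (norm_nonneg _) (hφ1 _)
    intro x
    have h2 := conv_inv _ g _ _ hg_int hsqi hm x
    have hcomm : ∀ a b : ℝ → ℝ, conv a b x = conv b a x := by
      intro a b
      unfold conv
      rw [← integral_sub_left_eq_self _ volume x]
      congr 1; ext y; rw [sub_sub_cancel, mul_comm]
    rw [hcomm]
    have : ((F x : ℝ) : ℂ) = ((conv (conv (fun y => 2 * F (2 * y)) (fun y => 2 * F (2 * y))) g x : ℝ) : ℂ) := by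
      rw [h2, hF]
      congr 2; ext t
      rw [hrec t]; ring
    exact_mod_cast this
  refine ⟨F, hFc, hFi, hF0, ?_, ?_, ?_, hfix, ?_⟩
  · have h := congrFun hft 0
    rw [hφ0, ft] at h
    simp only [Complex.ofReal_zero, mul_zero, zero_mul, neg_zero, Complex.exp_zero, mul_one] at h
    rw [integral_complex_ofReal] at h
    exact_mod_cast h
  · rw [show (fun ξ => ft F ξ) = φ from hft]; exact hφc
  · intro K hK
    rw [show (fun ξ => ft F ξ) = φ from hft]
    exact hunif K hK
  · intro x
    rw [hfix x]
    exact fixed2 F g hFi hFc _ hFb hg_int hg_cont x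
end

section
/- Suppose g is an even probability density on the circle and f(t,·) is an even probability-density solution of the Boltzmann equation ∂_t f(t,x) = ∫_{−π}^{π}∫_{−π}^{π}(f(t,x')f(t,x'+y)g(x−x'−y/2) − f(t,x)f(t,x+y)) β̃(y) (dx'/2π)(dy/2π). Then the Fourier coefficients satisfy a₀ = 1, a_{−k} = a_k, and for every k ≠ 0, d/dt a_k(t) = Σ_{n∈ℤ} a_{k−n}(t) a_n(t) (γ_k Γ(n − k/2) − Γ(n)); equivalently, for k ≥ 1, d/dt a_k = (2γ_kΓ(k/2) − Γ(0) − Γ(k)) a_k + Σ_{n=1}^{k−1}(γ_kΓ(n−k/2) − Γ(n)) a_n a_{k−n} + Σ_{n=k+1}^{∞}(2γ_kΓ(n−k/2) − Γ(n) − Γ(n−k)) a_n a_{n−k}. -/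
open MeasureTheory Real intervalIntegral

lemma aux_parseval (u v : ℝ → ℂ) (hu : Continuous u) (hv : Continuous v)
    (pu : Function.Periodic u (2 * π)) (pv : Function.Periodic v (2 * π)) :
    HasSum (fun n : ℤ =>
      ((1 / (2 * π) : ℂ) * ∫ x in (-π)..π, u x * Complex.exp (Complex.I * n * x)) *
      ((1 / (2 * π) : ℂ) * ∫ x in (-π)..π, v x * Complex.exp (-(Complex.I * n * x))))
      ((1 / (2 * π) : ℂ) * ∫ x in (-π)..π, u x * v x) := by
  have : Fact (0 < 2 * π) := ⟨two_pi_pos⟩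
  let U : C(AddCircle (2 * π), ℂ) := ⟨pu.lift, by
    exact continuous_coinduced_dom.2 hu⟩
  let V : C(AddCircle (2 * π), ℂ) := ⟨pv.lift, by
    exact continuous_coinduced_dom.2 hv⟩
  have hU : ∀ x : ℝ, U (x : AddCircle (2 * π)) = u x := fun x => pu.lift_coe x
  have hV : ∀ x : ℝ, V (x : AddCircle (2 * π)) = v x := fun x => pv.lift_coe x
  have key := (fourierBasis (T := 2 * π)).hasSum_inner_mul_inner
    (ContinuousMap.toLp 2 AddCircle.haarAddCircle ℂ (star U))
    (ContinuousMap.toLp 2 AddCircle.haarAddCircle ℂ V)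
  have e0 : -π + 2 * π = π := by ring
  have hco : ∀ (W : C(AddCircle (2 * π), ℂ)) (n : ℤ), fourierCoeff W n =
      (1 / (2 * π) : ℂ) * ∫ x in (-π)..π, W (x : AddCircle (2*π)) * Complex.exp (-(Complex.I * n * x)) := by
    intro W n
    rw [fourierCoeff_eq_intervalIntegral _ n (-π), e0, Complex.real_smul]
    congr 1
    · push_cast; rfl
    · apply intervalIntegral.integral_congr
      intro x _
      simp only [smul_eq_mul, fourier_coe_apply]
      rw [mul_comm]
      congr 2
      push_cast
      have : (π : ℂ) ≠ 0 := by exact_mod_cast pi_ne_zero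
      field_simp
  convert key using 1
  · rfl
  · funext n
    rw [← HilbertBasis.repr_apply_apply, fourierBasis_repr, fourierCoeff_toLp, hco V n]
    rw [← inner_conj_symm, ← HilbertBasis.repr_apply_apply, fourierBasis_repr, fourierCoeff_toLp]
    have : (starRingEnd ℂ) (fourierCoeff (⇑(star U)) n) = fourierCoeff U (-n) := by
      unfold fourierCoeff
      rw [← integral_conj]
      congr 1
      ext x
      simp
    rw [this, hco U (-n)]
    simp only [hU, hV]
    congr 4
    ext x
    congr 2
    push_cast
    ring
  · rw [ContinuousMap.inner_toLp]
    have := hco (U * V) 0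
    simp only [fourierCoeff, neg_zero, fourier_zero, one_smul] at this
    simp only [ContinuousMap.star_apply, RCLike.star_def, RingHomCompTriple.comp_apply, RingHom.id_apply]
    simp only [ContinuousMap.mul_apply, hU, hV] at this
    simp only [Int.cast_zero, mul_zero, zero_mul, neg_zero, Complex.exp_zero, mul_one] at this
    rw [← this]
    congr 1
    ext x
    simp [mul_comm]

lemma aux_shift_per {E : Type*} [NormedAddCommGroup E] [NormedSpace ℝ E] (F : ℝ → E)
    (hF : Function.Periodic F (2 * π)) (c : ℝ) :
    ∫ x in (-π)..π, F (x - c) = ∫ x in (-π)..π, F x := by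
  rw [intervalIntegral.integral_comp_sub_right]
  have := hF.intervalIntegral_add_eq (-π - c) (-π)
  convert this using 2 <;> ring

lemma aux_exp_per (k : ℤ) (x : ℝ) : Complex.exp (-(Complex.I * k * ((x + 2 * π : ℝ) : ℂ)))
    = Complex.exp (-(Complex.I * k * x)) := by
  rw [Complex.exp_eq_exp_iff_exists_int]
  refine ⟨-k, ?_⟩
  push_cast; ring

/-- modulated shift -/
lemma aux_shift (g : ℝ → ℝ) (hg : ∀ x, g (x + 2 * π) = g x) (k : ℤ) (c : ℝ) :
    ∫ x in (-π)..π, (g (x - c) : ℂ) * Complex.exp (-(Complex.I * k * x))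
      = Complex.exp (-(Complex.I * k * c)) *
        ∫ x in (-π)..π, (g x : ℂ) * Complex.exp (-(Complex.I * k * x)) := by
  rw [← aux_shift_per (fun x => (g x : ℂ) * Complex.exp (-(Complex.I * k * x))) _ c,
    ← intervalIntegral.integral_const_mul]
  · congr 1; ext x
    rw [mul_left_comm, ← Complex.exp_add]
    congr 2
    push_cast; ring
  · intro x
    simp only [hg, aux_exp_per]

lemma aux_gper_bound (g : ℝ → ℝ) (hg : ∀ x, g (x + 2 * π) = g x) (hpos : ∀ x, 0 ≤ g x)
    (hint : ∀ a b, IntervalIntegrable g volume a b) (c : ℝ) :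
    ∫ y in (-π)..π, g (c - y / 2) ≤ 2 * ∫ x in (-π)..π, g x := by
  have h1 : ∫ y in (-π)..π, g (c - y / 2) = 2 * ∫ x in (c - π/2)..(c+π/2), g x := by
    rw [intervalIntegral.integral_comp_sub_div _ (two_ne_zero)]
    simp only [smul_eq_mul]
    congr 3; ring
  have h2 : ∫ x in (c-π)..(c+π), g x = ∫ x in (-π)..π, g x := by
    have := Function.Periodic.intervalIntegral_add_eq (f := g) hg (c-π) (-π)
    convert this using 2 <;> ring
  rw [h1, ← h2]
  have := pi_pos
  gcongr
  apply intervalIntegral.integral_mono_interval <;> try linarith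
  · exact Filter.Eventually.of_forall hpos
  · exact hint _ _

lemma aux_K_int (g : ℝ → ℝ) (hg : ∀ x, g (x + 2 * π) = g x) (hpos : ∀ x, 0 ≤ g x)
    (hint : ∀ a b, IntervalIntegrable g volume a b) :
    Integrable (fun q : ℝ × ℝ × ℝ => g (q.1 - q.2.1 - q.2.2 / 2))
      ((volume.restrict (Set.Ioc (-π) π)).prod
        ((volume.restrict (Set.Ioc (-π) π)).prod (volume.restrict (Set.Ioc (-π) π)))) := by
  have hloc : LocallyIntegrable g volume := by
    rw [MeasureTheory.locallyIntegrable_iff]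
    intro K hK
    obtain ⟨R, hR⟩ := hK.isBounded.subset_closedBall 0
    have := (hint (-R) R)
    by_cases h : 0 ≤ R
    · rw [intervalIntegrable_iff_integrableOn_Icc_of_le (by linarith)] at this
      refine this.mono_set ?_
      rwa [Real.closedBall_eq_Icc, zero_sub, zero_add] at hR
    · have : K = ∅ := by
        rw [Metric.closedBall_eq_empty.2 (not_le.1 h)] at hR
        exact Set.subset_empty_iff.1 hR
      simp [this]
  have hm : AEStronglyMeasurable g volume := hloc.aestronglyMeasurable
  have hae : AEStronglyMeasurable (fun q : ℝ × ℝ × ℝ => g (q.1 - q.2.1 - q.2.2 / 2))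
      ((volume.restrict (Set.Ioc (-π) π)).prod
        ((volume.restrict (Set.Ioc (-π) π)).prod (volume.restrict (Set.Ioc (-π) π)))) := by
    refine hm.comp_quasiMeasurePreserving (f := fun q : ℝ × ℝ × ℝ => q.1 - q.2.1 - q.2.2 / 2) ?_
    refine QuasiMeasurePreserving.prod_of_left (by fun_prop)
      (Filter.Eventually.of_forall fun p => ?_)
    have := (measurePreserving_sub_right volume (p.1 + p.2/2)).quasiMeasurePreserving
    refine (Measure.QuasiMeasurePreserving.mono_left (f := fun x : ℝ => x - p.1 - p.2 / 2) ?_ Measure.restrict_le_self.absolutelyContinuous)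
    simpa only [sub_sub] using this
  have hpi := pi_pos
  rw [integrable_prod_iff' hae]
  have hs : ∀ p : ℝ × ℝ, ∫ x in (-π)..π, g (x - p.1 - p.2/2) = ∫ x in (-π)..π, g x := by
    intro p
    rw [← aux_shift_per g hg (p.1 + p.2/2)]
    congr 1; ext x; congr 1; ring
  constructor
  · refine Filter.Eventually.of_forall fun p => ?_
    have h := (hint (-π - (p.1+p.2/2)) (π - (p.1+p.2/2))).comp_sub_right (p.1 + p.2/2)
    simp only [sub_add_cancel] at h
    rw [intervalIntegrable_iff_integrableOn_Ioc_of_le (by linarith)] at h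
    refine h.congr (Filter.Eventually.of_forall fun x => ?_)
    simp only [sub_sub]
  · simp only [Real.norm_of_nonneg (hpos _)]
    simp only [← intervalIntegral.integral_of_le (show -π ≤ π by linarith), hs]
    exact integrable_const _


lemma aux_bdd (φ : ℝ → ℝ) (hφ : Continuous φ) (pφ : ∀ x, φ (x + 2 * π) = φ x) :
    ∃ M, ∀ x, |φ x| ≤ M := by
  have hp : Function.Periodic φ (2 * π) := pφ
  obtain ⟨M, hM⟩ := isBounded_iff_forall_norm_le.1 (hp.isBounded_of_continuous two_pi_pos.ne' hφ)
  exact ⟨M, fun x => hM _ ⟨x, rfl⟩⟩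

lemma aux_norm_exp (r : ℝ) (z : ℂ) (h : z = Complex.I * r) : ‖Complex.exp z‖ = 1 := by
  rw [h, mul_comm, Complex.norm_exp_ofReal_mul_I]

lemma aux_corr (φ : ℝ → ℝ) (hφ : Continuous φ) (pφ : ∀ x, φ (x + 2 * π) = φ x)
    (A : ℤ → ℂ) (hA : ∀ k : ℤ, A k =
      (1 / (2 * π) : ℂ) * ∫ x in (-π)..π, (φ x : ℂ) * Complex.exp (-(Complex.I * k * x)))
    (k : ℤ) (y : ℝ) :
    HasSum (fun n : ℤ => A (k - n) * A n * Complex.exp (Complex.I * n * y))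
      ((1 / (2 * π) : ℂ) *
        ∫ x in (-π)..π, (φ x : ℂ) * φ (x + y) * Complex.exp (-(Complex.I * k * x))) := by
  have h := aux_parseval (fun x => (φ x : ℂ) * Complex.exp (-(Complex.I * k * x)))
    (fun x => (φ (x + y) : ℂ)) (by fun_prop) (by fun_prop)
    (by intro x; simp only [pφ, aux_exp_per])
    (by intro x; simp only [add_right_comm x (2 * π) y, pφ])
  convert h using 1
  · funext n
    have h1 := aux_shift φ pφ n (-y)
    simp only [sub_neg_eq_add] at h1
    rw [h1, hA, hA]
    have e1 : Complex.exp (-(Complex.I * n * ((-y : ℝ) : ℂ))) = Complex.exp (Complex.I * n * y) := by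
      congr 1; push_cast; ring
    have e2 : ∀ x : ℝ, (φ x : ℂ) * Complex.exp (-(Complex.I * k * x)) * Complex.exp (Complex.I * n * x)
       = (φ x : ℂ) * Complex.exp (-(Complex.I * ((k - n : ℤ) : ℂ) * x)) := by
      intro x
      rw [mul_assoc, ← Complex.exp_add]
      congr 2; push_cast; ring
    simp only [e1, e2]
    ring
  · congr 3; funext x; ring

lemma aux_betasum (φ : ℝ → ℝ) (hφ : Continuous φ) (pφ : ∀ x, φ (x + 2 * π) = φ x)
    (A : ℤ → ℂ) (hA : ∀ k : ℤ, A k =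
      (1 / (2 * π) : ℂ) * ∫ x in (-π)..π, (φ x : ℂ) * Complex.exp (-(Complex.I * k * x)))
    (β : ℝ → ℝ) (hβ : Continuous β) (hβ1 : ∀ y, |β y| ≤ 1)
    (Γc : ℝ → ℂ)
    (hΓc : ∀ u : ℝ, Γc u =
      (1 / (2 * π) : ℂ) * ∫ y in (-π)..π, (β y : ℂ) * Complex.exp (Complex.I * u * y))
    (k : ℤ) (u : ℝ) :
    HasSum (fun n : ℤ => A (k - n) * A n * Γc (n - u))
      ((1 / (2 * π) : ℂ) * ∫ y in (-π)..π, (β y : ℂ) * Complex.exp (-(Complex.I * u * y)) *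
       ((1 / (2 * π) : ℂ) *
        ∫ x in (-π)..π, (φ x : ℂ) * φ (x + y) * Complex.exp (-(Complex.I * k * x)))) := by
  have hs : Summable (fun n : ℤ => ‖A (k - n) * A n‖) := by
    have := (aux_corr φ hφ pφ A hA k 0).summable.norm
    simpa using this
  have h := intervalIntegral.hasSum_integral_of_dominated_convergence (a := -π) (b := π)
    (μ := volume)
    (F := fun (n : ℤ) (y : ℝ) => (β y : ℂ) * Complex.exp (-(Complex.I * u * y)) *
      (A (k - n) * A n * Complex.exp (Complex.I * n * y)))
    (f := fun y => (β y : ℂ) * Complex.exp (-(Complex.I * u * y)) *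
       ((1 / (2 * π) : ℂ) *
        ∫ x in (-π)..π, (φ x : ℂ) * φ (x + y) * Complex.exp (-(Complex.I * k * x))))
    (fun n _ => ‖A (k - n) * A n‖)
    (fun n => Continuous.aestronglyMeasurable (by fun_prop))
    (fun n => Filter.Eventually.of_forall fun y _ => by
      rw [norm_mul, norm_mul, norm_mul (A (k - n) * A n),
        aux_norm_exp (-(u * y)) _ (by push_cast; ring),
        aux_norm_exp (n * y) _ (by push_cast; ring), Complex.norm_real, mul_one, mul_one]
      exact mul_le_of_le_one_left (norm_nonneg _) (hβ1 y))
    (Filter.Eventually.of_forall fun y _ => hs)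
    intervalIntegrable_const
    (Filter.Eventually.of_forall fun y _ => (aux_corr φ hφ pφ A hA k y).mul_left _)
  convert h.mul_left (1 / (2 * π) : ℂ) using 1
  · rfl
  funext n
  rw [hΓc, mul_left_comm, ← intervalIntegral.integral_const_mul]
  congr 2
  funext y
  have : Complex.exp (Complex.I * ((n - u : ℝ) : ℂ) * y) =
      Complex.exp (-(Complex.I * u * y)) * Complex.exp (Complex.I * n * y) := by
    rw [← Complex.exp_add]; congr 1; push_cast; ring
  rw [this]
  ring

lemma aux_Q (φ : ℝ → ℝ) (hφ : Continuous φ) (M : ℝ) (hM : ∀ x, |φ x| ≤ M)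
    (g : ℝ → ℝ) (hg : ∀ x, g (x + 2 * π) = g x) (hpos : ∀ x, 0 ≤ g x)
    (hint : ∀ a b, IntervalIntegrable g volume a b)
    (β : ℝ → ℝ) (hβ : Continuous β) (hβ1 : ∀ y, |β y| ≤ 1) (k : ℤ) :
    ∫ x in (-π)..π, ((∫ x' in (-π)..π, ∫ y in (-π)..π,
        (φ x' * φ (x' + y) * g (x - x' - y / 2) - φ x * φ (x + y)) * β y : ℝ) : ℂ)
        * Complex.exp (-(Complex.I * k * x)) =
      (∫ z in (-π)..π, (g z : ℂ) * Complex.exp (-(Complex.I * k * z))) *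
        (∫ y in (-π)..π, (β y : ℂ) * Complex.exp (-(Complex.I * (k / 2 : ℝ) * y)) *
         ∫ x in (-π)..π, (φ x : ℂ) * φ (x + y) * Complex.exp (-(Complex.I * k * x)))
      - 2 * π * ∫ y in (-π)..π, (β y : ℂ) *
         ∫ x in (-π)..π, (φ x : ℂ) * φ (x + y) * Complex.exp (-(Complex.I * k * x)) := by
  have hpi := pi_pos
  have hle : -π ≤ π := by linarith
  have hM0 : 0 ≤ M := (abs_nonneg _).trans (hM 0)
  simp only [intervalIntegral.integral_of_le hle]
  set μ := volume.restrict (Set.Ioc (-π) π) with hμ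
  let A : ℝ × ℝ × ℝ → ℂ := fun q => (φ q.2.1 : ℂ) * φ (q.2.1 + q.2.2) * β q.2.2 *
    Complex.exp (-(Complex.I * k * q.1))
  let B : ℝ × ℝ × ℝ → ℂ := fun q => (φ q.1 : ℂ) * φ (q.1 + q.2.2) * β q.2.2 *
    Complex.exp (-(Complex.I * k * q.1))
  have hb : ∀ a b c d : ℝ, ‖(φ a : ℂ) * φ b * β c * Complex.exp (-(Complex.I * k * d))‖ ≤ M * M * 1 * 1 := by
    intro a b c d
    rw [norm_mul, norm_mul, norm_mul, aux_norm_exp (-(k * d)) _ (by push_cast; ring)]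
    simp only [Complex.norm_real, Real.norm_eq_abs]
    have := hM a
    have := hM b
    have := hβ1 c
    gcongr
  have hA : Continuous A := by fun_prop
  have hB : Continuous B := by fun_prop
  have hK := (aux_K_int g hg hpos hint).ofReal (𝕜 := ℂ)
  have iA : Integrable (fun q : ℝ × ℝ × ℝ => A q * (g (q.1 - q.2.1 - q.2.2 / 2) : ℂ))
      (μ.prod (μ.prod μ)) :=
    hK.bdd_mul hA.aestronglyMeasurable (Filter.Eventually.of_forall fun q => hb _ _ _ _)
  have iB : Integrable B (μ.prod (μ.prod μ)) :=
    Integrable.of_bound hB.aestronglyMeasurable _ (Filter.Eventually.of_forall fun q => hb _ _ _ _)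
  have iAB : Integrable (fun q : ℝ × ℝ × ℝ => A q * (g (q.1 - q.2.1 - q.2.2 / 2) : ℂ) - B q)
      (μ.prod (μ.prod μ)) := iA.sub iB
  have step1 : ∫ x, ((∫ x', ∫ y,
        (φ x' * φ (x' + y) * g (x - x' - y / 2) - φ x * φ (x + y)) * β y ∂μ ∂μ : ℝ) : ℂ)
        * Complex.exp (-(Complex.I * k * x)) ∂μ =
      ∫ q, (A q * (g (q.1 - q.2.1 - q.2.2 / 2) : ℂ) - B q) ∂(μ.prod (μ.prod μ)) := by
    rw [integral_prod _ iAB]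
    apply MeasureTheory.integral_congr_ae
    filter_upwards [iAB.prod_right_ae] with x hx
    rw [integral_prod _ hx]
    simp only [← integral_complex_ofReal, ← MeasureTheory.integral_mul_const]
    congr 1; funext x'; congr 1; funext y
    simp only [A, B]
    push_cast
    ring
  have hC : ∀ (c : ℝ → ℂ), ∫ y, (β y : ℂ) * c y * ∫ x, (φ x : ℂ) * φ (x + y) *
      Complex.exp (-(Complex.I * k * x)) ∂μ ∂μ = ∫ y, ∫ x, (φ x : ℂ) * φ (x + y) * β y *
      Complex.exp (-(Complex.I * k * x)) * c y ∂μ ∂μ := by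
    intro c
    congr 1; funext y; rw [← MeasureTheory.integral_const_mul]; congr 1; funext x; ring
  rw [step1, MeasureTheory.integral_sub iA iB, integral_prod_symm _ iA, integral_prod_symm _ iB]
  congr 1
  · rw [← MeasureTheory.integral_const_mul]
    have e1 : ∀ p : ℝ × ℝ, ∫ x, A (x, p) * (g (x - p.1 - p.2 / 2) : ℂ) ∂μ =
        (∫ z, (g z : ℂ) * Complex.exp (-(Complex.I * k * z)) ∂μ) *
        ((φ p.1 : ℂ) * φ (p.1 + p.2) * β p.2 * Complex.exp (-(Complex.I * k * p.1)) *
          Complex.exp (-(Complex.I * (k / 2 : ℝ) * p.2))) := by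
      intro p
      have := aux_shift g hg k (p.1 + p.2 / 2)
      simp only [intervalIntegral.integral_of_le hle, ← hμ] at this
      have e2 : Complex.exp (-(Complex.I * k * ((p.1 + p.2 / 2 : ℝ) : ℂ))) =
          Complex.exp (-(Complex.I * k * p.1)) * Complex.exp (-(Complex.I * (k / 2 : ℝ) * p.2)) := by
        rw [← Complex.exp_add]; congr 1; push_cast; ring
      rw [e2] at this
      calc _ = ((φ p.1 : ℂ) * φ (p.1 + p.2) * β p.2) * ∫ x, (g (x - (p.1 + p.2 / 2)) : ℂ) *
          Complex.exp (-(Complex.I * k * x)) ∂μ := by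
            rw [← MeasureTheory.integral_const_mul]; congr 1; funext x; simp only [A, sub_sub]; ring
        _ = _ := by rw [this]; ring
    simp only [e1]
    rw [MeasureTheory.integral_const_mul, MeasureTheory.integral_const_mul, hC]
    congr 1
    rw [integral_prod_symm]
    refine Integrable.of_bound (Continuous.aestronglyMeasurable (by fun_prop)) (M * M * 1 * 1 * 1)
      (Filter.Eventually.of_forall fun p => ?_)
    rw [norm_mul, aux_norm_exp (-(k / 2 * p.2)) _ (by push_cast; ring)]
    have := hb p.1 (p.1 + p.2) p.2 p.1
    gcongr
  · have h1 := hC (fun _ => 1)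
    simp only [mul_one] at h1
    rw [h1]
    have i2 : Integrable (fun p : ℝ × ℝ => ∫ x, B (x, p) ∂μ) (μ.prod μ) := iB.integral_prod_right
    rw [integral_prod _ i2]
    simp only [B]
    rw [MeasureTheory.integral_const]
    have : μ.real Set.univ = 2 * π := by
      simp [hμ, hpi.le]; ring
    rw [this, Complex.real_smul]
    push_cast; rfl

lemma aux_bound (φ : ℝ → ℝ) (M : ℝ) (hM : ∀ x, |φ x| ≤ M)
    (g : ℝ → ℝ) (hg : ∀ x, g (x + 2 * π) = g x) (hpos : ∀ x, 0 ≤ g x)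
    (hint : ∀ a b, IntervalIntegrable g volume a b)
    (β : ℝ → ℝ) (hβ1 : ∀ y, |β y| ≤ 1) (x : ℝ) :
    ‖∫ x' in (-π)..π, ∫ y in (-π)..π,
        (φ x' * φ (x' + y) * g (x - x' - y / 2) - φ x * φ (x + y)) * β y‖ ≤
      (M * M * (2 * ∫ x in (-π)..π, g x) + M * M * (2 * π)) * |π - -π| := by
  have hpi := pi_pos
  have hle : -π ≤ π := by linarith
  have hM0 : 0 ≤ M := (abs_nonneg _).trans (hM 0)
  refine intervalIntegral.norm_integral_le_of_norm_le_const fun x' _ => ?_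
  have hi : IntervalIntegrable (fun y => g (x - x' - y / 2)) volume (-π) π := by
    have h1 := (hint (x - x' - -π/2) (x - x' - π/2)).comp_sub_left (x - x')
    have h2 := h1.comp_mul_left (c := 1/2)
    convert h2 using 1
    · funext y; congr 1; ring
    · ring
    · ring
  have hi2 : IntervalIntegrable (fun y => M * M * g (x - x' - y / 2) + M * M) volume (-π) π :=
    (hi.const_mul _).add intervalIntegrable_const
  refine (intervalIntegral.norm_integral_le_of_norm_le hle
    (Filter.Eventually.of_forall fun y _ => ?_) hi2).trans ?_
  · rw [norm_mul]
    simp only [Real.norm_eq_abs]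
    refine (mul_le_of_le_one_right (abs_nonneg _) (hβ1 y)).trans ?_
    refine (abs_sub _ _).trans ?_
    rw [abs_mul, abs_mul, abs_mul, abs_of_nonneg (hpos _)]
    have := hM x
    have := hM x'
    have := hM (x + y)
    have := hM (x' + y)
    have := hpos (x - x' - y / 2)
    gcongr
  · rw [intervalIntegral.integral_add (hi.const_mul _) intervalIntegrable_const,
      intervalIntegral.integral_const_mul, intervalIntegral.integral_const]
    have := aux_gper_bound g hg hpos hint (x - x')
    have e : (π - -π) • (M * M) = M * M * (2 * π) := by simp; ring
    rw [e]
    gcongr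

lemma aux_rearr (H : ℤ → ℂ) (S : ℂ) (h : HasSum H S) (k : ℤ) (hk : 1 ≤ k) :
    S = H 0 + H k + (∑ n ∈ Finset.Ico (1 : ℤ) k, H n) +
      ∑' m : ℕ, (H (k + 1 + m) + H (-((m : ℤ) + 1))) := by
  obtain ⟨K, rfl⟩ := Int.eq_ofNat_of_zero_le (show 0 ≤ k by omega)
  have hs1 : Summable (fun n : ℕ => H n) :=
    h.summable.comp_injective (i := fun n : ℕ => (n : ℤ)) (fun a b => by simp)
  have hs2 : Summable (fun n : ℕ => H (-((n : ℤ) + 1))) :=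
    h.summable.comp_injective (i := fun n : ℕ => (-((n : ℤ) + 1))) (fun a b => by simp)
  have hs3 : Summable (fun n : ℕ => H ((K : ℤ) + 1 + n)) :=
    h.summable.comp_injective (i := fun n : ℕ => ((K : ℤ) + 1 + n)) (fun a b => by simp)
  rw [← h.tsum_eq, tsum_of_nat_of_neg_add_one hs1 hs2, hs3.tsum_add hs2,
    ← hs1.sum_add_tsum_nat_add (K + 1)]
  have e1 : ∑' i : ℕ, H ((i + (K + 1) : ℕ) : ℤ) = ∑' i : ℕ, H ((K : ℤ) + 1 + i) := by
    congr 1; funext i; congr 1; push_cast; ring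
  have e2 : ∑ n ∈ Finset.Ico (1 : ℤ) K, H n = ∑ n ∈ Finset.Ico 1 K, H (n : ℤ) := by
    have : Finset.Ico (1 : ℤ) K = (Finset.Ico 1 K).image (fun n : ℕ => (n : ℤ)) := by
      ext z
      simp only [Finset.mem_Ico, Finset.mem_image]
      constructor
      · rintro ⟨h1, h2⟩
        exact ⟨z.toNat, by omega, by omega⟩
      · rintro ⟨n, hn, rfl⟩
        omega
    rw [this, Finset.sum_image (fun a _ b _ hab => by simpa using hab)]
  rw [e1, e2, Finset.sum_range_succ, Finset.sum_range_eq_add_Ico _ (show 0 < K by omega)]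
  push_cast
  ring

lemma aux_main
    (β : ℝ → ℝ) (hβ : Continuous β) (hβ1 : ∀ y, |β y| ≤ 1)
    (g : ℝ → ℝ) (hg : ∀ x, g (x + 2 * π) = g x) (hpos : ∀ x, 0 ≤ g x)
    (hint : ∀ a b, IntervalIntegrable g volume a b)
    (f : ℝ → ℝ → ℝ)
    (hf_cont : Continuous (Function.uncurry f))
    (hf_per : ∀ t x, f t (x + 2 * π) = f t x)
    (hPDE : ∀ t x, HasDerivAt (fun s => f s x)
      ((1 / (2 * π) ^ 2) * ∫ x' in (-π)..π, ∫ y in (-π)..π,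
        (f t x' * f t (x' + y) * g (x - x' - y / 2) - f t x * f t (x + y)) * β y) t)
    (a : ℝ → ℤ → ℂ)
    (ha : ∀ t (k : ℤ), a t k =
      (1 / (2 * π) : ℂ) * ∫ x in (-π)..π, (f t x : ℂ) * Complex.exp (-(Complex.I * k * x)))
    (γc : ℤ → ℂ)
    (hγc : ∀ k : ℤ, γc k =
      (1 / (2 * π) : ℂ) * ∫ z in (-π)..π, (g z : ℂ) * Complex.exp (-(Complex.I * k * z)))
    (Γc : ℝ → ℂ)
    (hΓc : ∀ u : ℝ, Γc u =
      (1 / (2 * π) : ℂ) * ∫ y in (-π)..π, (β y : ℂ) * Complex.exp (Complex.I * u * y))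
    (k : ℤ) (t : ℝ) :
    ∃ S : ℂ, HasSum (fun n : ℤ =>
        a t (k - n) * a t n * (γc k * Γc ((n : ℝ) - (k : ℝ) / 2) - Γc (n : ℝ))) S ∧
      HasDerivAt (fun s => a s k) S t := by
  have hfc : ∀ s, Continuous (f s) := fun s => hf_cont.comp (by fun_prop : Continuous fun x => (s, x))
  obtain ⟨M, hM⟩ : ∃ M, ∀ s ∈ Set.Icc (t - 1) (t + 1), ∀ x, |f s x| ≤ M := by
    obtain ⟨M, hM⟩ := (isCompact_Icc (a := t - 1) (b := t + 1)).prod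
      (isCompact_Icc (a := -π) (b := π)) |>.exists_bound_of_continuousOn hf_cont.continuousOn
    refine ⟨M, fun s hs x => ?_⟩
    obtain ⟨y, hy, hxy⟩ := Function.Periodic.exists_mem_Ico (f := f s) (hf_per s) two_pi_pos x (-π)
    rw [hxy]
    exact hM (s, y) ⟨hs, hy.1, by have := hy.2; linarith⟩
  have hMt : ∀ x, |f t x| ≤ M := hM t ⟨by linarith, by linarith⟩
  set Q : ℝ → ℝ → ℝ := fun s x => ∫ x' in (-π)..π, ∫ y in (-π)..π,
        (f s x' * f s (x' + y) * g (x - x' - y / 2) - f s x * f s (x + y)) * β y with hQ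
  have hmeas : Measurable (fun x => (1 / (2 * π) ^ 2) * Q t x) := by
    have h1 : Measurable (fun p : ℝ × ℝ => deriv (fun s => f s p.1) p.2) :=
      measurable_deriv_with_param (f := fun x s => f s x)
        (hf_cont.comp (continuous_swap))
    have h2 : Measurable (fun x : ℝ => deriv (fun s => f s x) t) :=
      h1.comp (by fun_prop : Measurable fun x : ℝ => (x, t))
    convert h2 using 2 with x
    exact (hPDE t x).deriv.symm
  have hder := intervalIntegral.hasDerivAt_integral_of_dominated_loc_of_deriv_le (μ := volume)
    (a := -π) (b := π) (x₀ := t) (s := Set.Icc (t - 1) (t + 1))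
    (F := fun s x => (f s x : ℂ) * Complex.exp (-(Complex.I * k * x)))
    (F' := fun s x => (((1 / (2 * π) ^ 2) * Q s x : ℝ) : ℂ) * Complex.exp (-(Complex.I * k * x)))
    (bound := fun _ => |1 / (2 * π) ^ 2| *
      ((M * M * (2 * ∫ x in (-π)..π, g x) + M * M * (2 * π)) * |π - -π|))
    (Icc_mem_nhds (by linarith) (by linarith))
    (Filter.Eventually.of_forall fun s => by
      have := hfc s
      exact Continuous.aestronglyMeasurable (by fun_prop))
    (by
      have := hfc t
      exact Continuous.intervalIntegrable (by fun_prop) _ _)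
    ((Complex.measurable_ofReal.comp hmeas).aestronglyMeasurable.mul
      (Continuous.aestronglyMeasurable (by fun_prop)))
    (Filter.Eventually.of_forall fun x _ s hs => by
      rw [norm_mul, aux_norm_exp (-(k * x)) _ (by push_cast; ring), mul_one, Complex.norm_real,
        norm_mul, Real.norm_eq_abs (1 / (2 * π) ^ 2)]
      exact mul_le_mul_of_nonneg_left (aux_bound (f s) M (hM s hs) g hg hpos hint β hβ1 x)
        (abs_nonneg _))
    intervalIntegrable_const
    (Filter.Eventually.of_forall fun x _ s hs => by
      exact ((hPDE s x).ofReal_comp).mul_const _)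
  have hder2 := hder.2.const_mul (1 / (2 * π) : ℂ)
  have h1 := (aux_betasum (f t) (hfc t) (hf_per t) (a t) (ha t) β hβ hβ1 Γc hΓc k (k / 2)).mul_left (γc k)
  have h2 := aux_betasum (f t) (hfc t) (hf_per t) (a t) (ha t) β hβ hβ1 Γc hΓc k 0
  have h3 := h1.sub h2
  refine ⟨_, ?_, (?_ : HasDerivAt _ ((1 / (2 * π) : ℂ) * ∫ x in (-π)..π,
    (((1 / (2 * π) ^ 2) * Q t x : ℝ) : ℂ) * Complex.exp (-(Complex.I * k * x))) t)⟩
  rotate_left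
  · simp only [ha _ k]
    exact hder2
  · convert h3 using 1
    · rfl
    · funext n
      simp only [sub_zero]
      ring
    · have hq := aux_Q (f t) (hfc t) M hMt g hg hpos hint β hβ hβ1 k
      have e : ∀ x : ℝ, (((1 / (2 * π) ^ 2) * Q t x : ℝ) : ℂ) * Complex.exp (-(Complex.I * k * x)) =
        (1 / (2 * π) : ℂ) ^ 2 * ((Q t x : ℂ) * Complex.exp (-(Complex.I * k * x))) := by
        intro x; push_cast; ring
      have e3 : ∀ (c d : ℝ → ℂ) , ∫ y in (-π)..π, c y * ((1 / (2 * π) : ℂ) * d y) =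
          (1 / (2 * π) : ℂ) * ∫ y in (-π)..π, c y * d y := by
        intro c d
        rw [← intervalIntegral.integral_const_mul]
        congr 1; funext y; ring
      have hpi : (π : ℂ) ≠ 0 := by exact_mod_cast pi_ne_zero
      simp only [e]
      rw [intervalIntegral.integral_const_mul, hq, hγc, e3, e3]
      simp only [Complex.ofReal_zero, mul_zero, zero_mul, neg_zero, Complex.exp_zero, mul_one]
      field_simp


lemma aux_reflect (F : ℝ → ℂ) : ∫ x in (-π)..π, F (-x) = ∫ x in (-π)..π, F x := by
  rw [intervalIntegral.integral_comp_neg, neg_neg]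

/-- If `g` is an even probability density on the circle and `f(t,·)` is an
even probability-density solution of the BDG Boltzmann equation, then the Fourier coefficients
`a_k(t) = (2π)⁻¹ ∫_{-π}^{π} f(t,x) e^{-ikx} dx` satisfy `a₀ = 1`, `a_{-k} = a_k`, and for every
`k ≠ 0`,
`d/dt a_k = Σ_{n∈ℤ} a_{k-n} a_n (γ_k Γ(n - k/2) - Γ(n))`;
equivalently, for `k ≥ 1`,
`d/dt a_k = (2γ_kΓ(k/2) - Γ(0) - Γ(k)) a_k + Σ_{n=1}^{k-1}(γ_kΓ(n-k/2) - Γ(n)) a_n a_{k-n}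
  + Σ_{n=k+1}^{∞}(2γ_kΓ(n-k/2) - Γ(n) - Γ(n-k)) a_n a_{n-k}`. -/
theorem stmt_5
    (tbeta : ℝ → ℝ)
    (hbeta : (∀ y, tbeta y = 1) ∨ (∀ y, tbeta y = |Real.sin (y / 2)|))
    (g : ℝ → ℝ)
    (hg_per : ∀ x, g (x + 2 * π) = g x)
    (hg_even : ∀ x, g (-x) = g x)
    (hg_nonneg : ∀ x, 0 ≤ g x)
    (hg_mass : (1 / (2 * π)) * ∫ z in (-π)..π, g z = 1)
    (f : ℝ → ℝ → ℝ)
    (hf_cont : Continuous (Function.uncurry f))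
    (hf_per : ∀ t x, f t (x + 2 * π) = f t x)
    (hf_even : ∀ t x, f t (-x) = f t x)
    (hf_nonneg : ∀ t x, 0 ≤ f t x)
    (hf_mass : ∀ t, (1 / (2 * π)) * ∫ x in (-π)..π, f t x = 1)
    (hPDE : ∀ t x, HasDerivAt (fun s => f s x)
      ((1 / (2 * π) ^ 2) * ∫ x' in (-π)..π, ∫ y in (-π)..π,
        (f t x' * f t (x' + y) * g (x - x' - y / 2) - f t x * f t (x + y)) * tbeta y) t)
    (a : ℝ → ℤ → ℂ)
    (ha : ∀ t (k : ℤ), a t k =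
      (1 / (2 * π) : ℂ) * ∫ x in (-π)..π, (f t x : ℂ) * Complex.exp (-(Complex.I * k * x)))
    (γc : ℤ → ℂ)
    (hγc : ∀ k : ℤ, γc k =
      (1 / (2 * π) : ℂ) * ∫ z in (-π)..π, (g z : ℂ) * Complex.exp (-(Complex.I * k * z)))
    (Γc : ℝ → ℂ)
    (hΓc : ∀ u : ℝ, Γc u =
      (1 / (2 * π) : ℂ) * ∫ y in (-π)..π, (tbeta y : ℂ) * Complex.exp (Complex.I * u * y)) :
    (∀ t, a t 0 = 1) ∧
    (∀ t (k : ℤ), a t (-k) = a t k) ∧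
    (∀ k : ℤ, k ≠ 0 → ∀ t, HasDerivAt (fun s => a s k)
      (∑' n : ℤ, a t (k - n) * a t n * (γc k * Γc ((n : ℝ) - (k : ℝ) / 2) - Γc (n : ℝ))) t) ∧
    (∀ k : ℤ, 1 ≤ k → ∀ t, HasDerivAt (fun s => a s k)
      ((2 * γc k * Γc ((k : ℝ) / 2) - Γc 0 - Γc (k : ℝ)) * a t k
        + (∑ n ∈ Finset.Ico (1 : ℤ) k,
            (γc k * Γc ((n : ℝ) - (k : ℝ) / 2) - Γc (n : ℝ)) * a t n * a t (k - n))
        + ∑' m : ℕ,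
            (2 * γc k * Γc (((k : ℝ) + 1 + (m : ℝ)) - (k : ℝ) / 2)
              - Γc ((k : ℝ) + 1 + (m : ℝ)) - Γc ((m : ℝ) + 1))
              * a t (k + 1 + (m : ℤ)) * a t ((m : ℤ) + 1)) t) := by
  have hpi := pi_pos
  have hβ : Continuous tbeta := by
    rcases hbeta with h | h
    · rw [funext h]; fun_prop
    · rw [funext h]; fun_prop
  have hβ1 : ∀ y, |tbeta y| ≤ 1 := by
    intro y
    rcases hbeta with h | h
    · simp [h]
    · rw [h, abs_abs]; exact Real.abs_sin_le_one _
  have hβe : ∀ y, tbeta (-y) = tbeta y := by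
    intro y
    rcases hbeta with h | h
    · simp [h]
    · rw [h, h, neg_div, Real.sin_neg, abs_neg]
  have hint0 : IntervalIntegrable g volume (-π) π := by
    apply intervalIntegral.intervalIntegrable_of_integral_ne_zero
    intro h
    rw [h] at hg_mass
    simp at hg_mass
  have hint : ∀ a b, IntervalIntegrable g volume a b := by
    refine Function.Periodic.intervalIntegrable (f := g) (T := 2 * π) hg_per two_pi_pos.ne' (t := -π) ?_
    convert hint0 using 1; ring
  have heven : ∀ t (k : ℤ), a t (-k) = a t k := by
    intro t k
    rw [ha, ha]
    congr 1
    rw [← aux_reflect]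
    congr 1; funext x
    rw [hf_even]
    congr 2
    push_cast; ring
  have hΓe : ∀ u, Γc (-u) = Γc u := by
    intro u
    rw [hΓc, hΓc]
    congr 1
    rw [← aux_reflect]
    congr 1; funext x
    rw [hβe]
    congr 2
    push_cast; ring
  have main := aux_main tbeta hβ hβ1 g hg_per hg_nonneg hint f hf_cont hf_per hPDE a ha γc hγc Γc hΓc
  refine ⟨?_, heven, ?_, ?_⟩
  · intro t
    rw [ha]
    have := congrArg (fun r : ℝ => (r : ℂ)) (hf_mass t)
    simp only [Complex.ofReal_mul, ← intervalIntegral.integral_ofReal] at this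
    simpa using this
  · intro k _ t
    obtain ⟨S, hS, hd⟩ := main k t
    rw [hS.tsum_eq]
    exact hd
  · intro k hk t
    obtain ⟨S, hS, hd⟩ := main k t
    rw [aux_rearr _ S hS k hk] at hd
    convert hd using 1
    have e0 : Γc ((0 : ℝ) - k / 2) = Γc (k / 2) := by rw [← hΓe]; congr 1; ring
    have a0 : a t 0 = 1 := by
      rw [ha]
      have := congrArg (fun r : ℝ => (r : ℂ)) (hf_mass t)
      simp only [Complex.ofReal_mul, ← intervalIntegral.integral_ofReal] at this
      simpa using this
    congr 1
    · congr 1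
      · have e1 : (k : ℝ) - k / 2 = k / 2 := by ring
        simp only [sub_zero, sub_self, Int.cast_zero, e0, a0, e1]
        ring
      · apply Finset.sum_congr rfl
        intro n _
        ring
    · congr 1; funext m
      have e1 : Γc (((-((m : ℤ) + 1) : ℤ) : ℝ) - k / 2) = Γc (((k : ℝ) + 1 + (m : ℝ)) - k / 2) := by
        rw [← hΓe]; congr 1; push_cast; ring
      have e2 : Γc ((-((m : ℤ) + 1) : ℤ) : ℝ) = Γc ((m : ℝ) + 1) := by
        rw [← hΓe]; congr 1; push_cast; ring
      have e3 : a t (k - (k + 1 + m)) = a t ((m : ℤ) + 1) := by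
        rw [← heven]; congr 1; ring
      have e4 : a t (k - -((m : ℤ) + 1)) = a t (k + 1 + m) := by
        congr 1; ring
      rw [e1, e2, e3, e4, heven]
      push_cast
      ring
end

section
/- Under the Hypothesis on the noise family g_{γ₁} and for the Maxwellian Fourier dynamics, there exists γ_max > π/4 such that for every γ₁ with π/4 < γ₁ < γ_max there exists a nonuniform stationary solution (ā_k(γ₁))_{k≥0} with ā₀ = 1, ā_k = 0 for all k > N, and ā₁(γ₁) = √(12(γ₁ − π/4)/(π γ₂(π/4))) + O((γ₁ − π/4)^{3/2}) as γ₁ → (π/4)⁺; in particular the bifurcation has critical exponent 1/2. -/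
open Real

/-- Maxwellian kernel transform: `Γ(u) = sin(πu)/(πu)` for `u ≠ 0`, `Γ(0) = 1`. -/
noncomputable def Gam (u : ℝ) : ℝ :=
  if u = 0 then 1 else Real.sin (π * u) / (π * u)


open Filter Topology

theorem ift_fix {E : Type*} [NormedAddCommGroup E] [NormedSpace ℝ E] [CompleteSpace E]
    (K : ℝ × E → E) (x0 : E) (hK : ContDiffAt ℝ 1 K (0, x0)) (h0 : ∀ x, K (0, x) = x0) :
    ∃ X : ℝ → E, DifferentiableAt ℝ X 0 ∧ X 0 = x0 ∧ ∀ᶠ s in 𝓝 (0 : ℝ), X s = K (s, X s) := by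
  have cdf : ContDiffAt ℝ 1 (fun p : ℝ × E => p.2 - K p) (0, x0) := contDiffAt_snd.sub hK
  have hd : DifferentiableAt ℝ K (0, x0) := hK.differentiableAt (by norm_num)
  have h1 : fderiv ℝ K (0, x0) ∘L .inr ℝ ℝ E = 0 := by
    have e1 : HasFDerivAt (fun x : E => K (0, x)) (fderiv ℝ K (0, x0) ∘L .inr ℝ ℝ E) x0 :=
      HasFDerivAt.comp (f := fun x : E => ((0 : ℝ), x)) x0 hd.hasFDerivAt
        (hasFDerivAt_prodMk_right (0 : ℝ) x0)
    have e2 : HasFDerivAt (fun x : E => K (0, x)) (0 : E →L[ℝ] E) x0 := by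
      simp only [h0]; exact hasFDerivAt_const _ _
    exact e1.unique e2
  have h2 : fderiv ℝ (fun p : ℝ × E => p.2 - K p) (0, x0) ∘L .inr ℝ ℝ E = .id ℝ E := by
    have e : fderiv ℝ (fun p : ℝ × E => p.2 - K p) (0, x0) = .snd ℝ ℝ E - fderiv ℝ K (0, x0) :=
      (hasFDerivAt_snd.sub hd.hasFDerivAt).fderiv
    rw [e, ContinuousLinearMap.sub_comp, h1]
    simp
  have hinv : (fderiv ℝ (fun p : ℝ × E => p.2 - K p) (0, x0) ∘L .inr ℝ ℝ E).IsInvertible := by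
    rw [h2]; exact ⟨ContinuousLinearEquiv.refl ℝ E, rfl⟩
  refine ⟨cdf.implicitFunction one_ne_zero hinv, ?_, cdf.implicitFunction_apply_self _ hinv, ?_⟩
  · exact (cdf.hasStrictFDerivAt_implicitFunction one_ne_zero hinv).hasFDerivAt.differentiableAt
  · filter_upwards [cdf.eventually_apply_implicitFunction one_ne_zero hinv] with s hs
    simp only [h0, sub_self] at hs
    exact sub_eq_zero.mp hs

noncomputable def yy (N : ℕ) (p : ℝ × (Fin (N + 1) → ℝ)) (k : ℕ) : ℝ :=
  if h : k < N + 1 then p.2 ⟨k, h⟩ else 0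

noncomputable def tt {N : ℕ} (p : ℝ × (Fin (N + 1) → ℝ)) : ℝ := π / 4 + p.1 ^ 2

noncomputable def dd (γ : ℕ → ℝ → ℝ) (N : ℕ) (p : ℝ × (Fin (N + 1) → ℝ)) (k : ℕ) : ℝ :=
  if k = 2 then γ 2 (tt p) * yy N p 1 ^ 2 else yy N p k

noncomputable def cc (γ : ℕ → ℝ → ℝ) (N : ℕ) (p : ℝ × (Fin (N + 1) → ℝ)) (k : ℕ) : ℝ :=
  if k = 1 then yy N p 1 else p.1 * dd γ N p k

noncomputable def SS (γ : ℕ → ℝ → ℝ) (N k : ℕ) (p : ℝ × (Fin (N + 1) → ℝ)) : ℝ :=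
  (∑ n ∈ Finset.Ico 1 k, Gam ((n : ℝ) - (k : ℝ) / 2) * cc γ N p n * cc γ N p (k - n))
  + 2 * (∑ m ∈ Finset.range (N + 1), Gam (((k : ℝ) + 1 + (m : ℝ)) - (k : ℝ) / 2)
                  * cc γ N p (k + 1 + m) * cc γ N p (m + 1))

noncomputable def RR (γ : ℕ → ℝ → ℝ) (N : ℕ) (p : ℝ × (Fin (N + 1) → ℝ)) : ℝ :=
  ∑ m ∈ Finset.range N, Gam ((m : ℝ) + 5 / 2) * dd γ N p (m + 3) * dd γ N p (m + 2)

noncomputable def QQ (γ : ℕ → ℝ → ℝ) (N : ℕ) (p : ℝ × (Fin (N + 1) → ℝ)) : ℝ :=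
  3 / (tt p * γ 2 (tt p)) * (1 + p.1 * (tt p * (π / 2) * RR γ N p / yy N p 1))

noncomputable def KK (γ : ℕ → ℝ → ℝ) (N k : ℕ) (p : ℝ × (Fin (N + 1) → ℝ)) : ℝ :=
  if k = 1 then Real.sqrt (QQ γ N p)
  else if 3 ≤ k then γ k (tt p) / (1 - 2 * γ k (tt p) * Gam ((k : ℝ) / 2)) * SS γ N k p
  else 0

theorem Gam_half : Gam (1 / 2) = 2 / π := by
  have := Real.pi_pos
  unfold Gam
  rw [if_neg (by norm_num), show π * (1 / 2) = π / 2 by ring, Real.sin_pi_div_two]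
  field_simp

theorem Gam_three_half : Gam (3 / 2) = -2 / (3 * π) := by
  have := Real.pi_pos
  unfold Gam
  rw [if_neg (by norm_num), show π * (3 / 2) = π / 2 + π by ring, Real.sin_add_pi,
    Real.sin_pi_div_two]
  field_simp
  norm_num

theorem Gam_nat (n : ℕ) (hn : n ≠ 0) : Gam n = 0 := by
  unfold Gam
  rw [if_neg (by exact_mod_cast hn), mul_comm π, Real.sin_nat_mul_pi, zero_div]

theorem Gam_zero : Gam 0 = 1 := by simp [Gam]

theorem denom_pos (k : ℕ) (hk : 3 ≤ k) (g : ℝ) (hg : g ∈ Set.Icc (-1 : ℝ) 1) :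
    0 < 1 - 2 * g * Gam ((k : ℝ) / 2) := by
  have hk' : (3 : ℝ) ≤ k := by exact_mod_cast hk
  have hp := Real.pi_gt_three
  have hG : |Gam ((k : ℝ) / 2)| ≤ 1 / 4 := by
    unfold Gam
    rw [if_neg (by positivity), abs_div, div_le_iff₀ (by positivity)]
    refine (Real.abs_sin_le_one _).trans ?_
    rw [abs_of_pos (by positivity)]
    nlinarith
  have h2 : |g * Gam ((k : ℝ) / 2)| ≤ 1 * (1 / 4) := by
    rw [abs_mul]
    exact mul_le_mul (abs_le.mpr hg) hG (abs_nonneg _) (by norm_num)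
  have := (abs_le.mp h2).2
  linarith

theorem yy_high (N : ℕ) (p : ℝ × (Fin (N + 1) → ℝ)) (k : ℕ) (h : N < k) : yy N p k = 0 := by
  unfold yy; rw [dif_neg (by omega)]

theorem cc_high (γ : ℕ → ℝ → ℝ) (N : ℕ) (hN : 2 ≤ N) (p : ℝ × (Fin (N + 1) → ℝ)) (k : ℕ)
    (h : N < k) : cc γ N p k = 0 := by
  unfold cc dd; rw [if_neg (by omega), if_neg (by omega), yy_high N p k h, mul_zero]

/-- Algebraic verification of the stationary equations from the fixed point relations. -/
theorem stationary
    (N : ℕ) (hN : 2 ≤ N) (γ : ℕ → ℝ → ℝ)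
    (hγ1 : ∀ s, γ 1 s = s)
    (hγhigh : ∀ k, N < k → ∀ s, γ k s = 0)
    (hγrange : ∀ k, 2 ≤ k → k ≤ N → ∀ s ∈ Set.Icc (0 : ℝ) 1, γ k s ∈ Set.Icc (-1 : ℝ) 1)
    (hγ2pos : ∀ s ∈ Set.Icc (0 : ℝ) 1, 0 < γ 2 s)
    (p : ℝ × (Fin (N + 1) → ℝ)) (ht : tt p ∈ Set.Icc (0 : ℝ) 1)
    (hρ : 0 < yy N p 1) (hQ : yy N p 1 ^ 2 = QQ γ N p)
    (hfix : ∀ k, 3 ≤ k → k ≤ N → yy N p k = KK γ N k p)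
    (a : ℕ → ℝ) (ha : ∀ k, 1 ≤ k → a k = p.1 * cc γ N p k) (k : ℕ) (hk : 1 ≤ k) :
    a k = 2 * γ k (tt p) * Gam ((k : ℝ) / 2) * a k
              + γ k (tt p) * (∑ n ∈ Finset.Ico 1 k,
                  Gam ((n : ℝ) - (k : ℝ) / 2) * a n * a (k - n))
              + 2 * γ k (tt p) * (∑' m : ℕ, Gam (((k : ℝ) + 1 + (m : ℝ)) - (k : ℝ) / 2)
                  * a (k + 1 + m) * a (m + 1)) := by
  by_cases hkN : N < k
  · rw [hγhigh k hkN, ha k hk, cc_high γ N hN p k hkN]; simp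
  have hts : (∑' m : ℕ, Gam (((k : ℝ) + 1 + (m : ℝ)) - (k : ℝ) / 2) * a (k + 1 + m) * a (m + 1))
      = ∑ m ∈ Finset.range (N + 1),
        Gam (((k : ℝ) + 1 + (m : ℝ)) - (k : ℝ) / 2) * a (k + 1 + m) * a (m + 1) := by
    apply tsum_eq_sum
    intro m hm
    rw [Finset.mem_range] at hm
    rw [ha (k + 1 + m) (by omega), cc_high γ N hN p _ (by omega)]; simp
  rw [hts]
  have hpi := Real.pi_pos
  have htpos : 0 < tt p := by unfold tt; positivity
  have hγ2 := hγ2pos _ ht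
  have hc1 : cc γ N p 1 = yy N p 1 := by simp [cc]
  have hc2 : cc γ N p 2 = p.1 * (γ 2 (tt p) * yy N p 1 ^ 2) := by simp [cc, dd]
  rcases (by omega : k = 1 ∨ k = 2 ∨ 3 ≤ k) with h | h | h
  · subst h
    rw [Finset.sum_range_succ']
    have e : ∑ m ∈ Finset.range N, Gam ((((1 : ℕ) : ℝ) + 1 + ((m + 1 : ℕ) : ℝ)) - ((1 : ℕ) : ℝ) / 2)
        * a (1 + 1 + (m + 1)) * a (m + 1 + 1) = p.1 ^ 4 * RR γ N p := by
      unfold RR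
      rw [Finset.mul_sum]
      refine Finset.sum_congr rfl fun m _ => ?_
      rw [ha _ (by omega), ha _ (by omega),
        show 1 + 1 + (m + 1) = m + 3 by ring, show m + 1 + 1 = m + 2 by ring]
      unfold cc
      rw [if_neg (by omega), if_neg (by omega)]
      push_cast
      rw [show (1 : ℝ) + 1 + (m + 1) - 1 / 2 = m + 5 / 2 by ring]
      ring
    rw [e, hγ1]
    simp only [Finset.Ico_self, Finset.sum_empty]
    rw [ha 1 le_rfl, ha (1 + 1 + 0) (by omega)]
    simp only [Nat.reduceAdd]
    rw [hc1, hc2]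
    push_cast
    rw [show (1 : ℝ) + 1 + 0 - 1 / 2 = 3 / 2 by norm_num, Gam_half, Gam_three_half]
    have key : yy N p 1 ^ 3 * (tt p * γ 2 (tt p)) = 3 * yy N p 1 + 3 * p.1 * (tt p * (π / 2) * RR γ N p) := by
      rw [pow_succ, hQ]
      unfold QQ
      field_simp
    have hs : p.1 ^ 2 = tt p - π / 4 := by unfold tt; ring
    generalize yy N p 1 = ρ at *
    generalize γ 2 (tt p) = g at *
    generalize RR γ N p = R at *
    generalize tt p = t at *
    generalize p.1 = s at *
    have ht' : t = π / 4 + s ^ 2 := by linarith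
    field_simp
    rw [ht'] at key ⊢
    linear_combination 4 * s ^ 3 * key
  · subst h
    have e0 : ∑ m ∈ Finset.range (N + 1),
        Gam ((((2 : ℕ) : ℝ) + 1 + (m : ℝ)) - ((2 : ℕ) : ℝ) / 2) * a (2 + 1 + m) * a (m + 1) = 0 := by
      refine Finset.sum_eq_zero fun m _ => ?_
      have : ((2 : ℕ) : ℝ) + 1 + (m : ℝ) - ((2 : ℕ) : ℝ) / 2 = ((m + 2 : ℕ) : ℝ) := by
        push_cast; ring
      rw [this, Gam_nat _ (by omega)]; ring
    have e1 : Gam (((2 : ℕ) : ℝ) / 2) = 0 := by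
      rw [show ((2 : ℕ) : ℝ) / 2 = ((1 : ℕ) : ℝ) by norm_num, Gam_nat 1 (by omega)]
    rw [e0, e1, show Finset.Ico 1 2 = {1} by rfl, Finset.sum_singleton]
    rw [show ((1 : ℕ) : ℝ) - ((2 : ℕ) : ℝ) / 2 = 0 by norm_num, Gam_zero, ha 2 (by omega), hc2,
      show 2 - 1 = 1 by rfl, ha 1 le_rfl, hc1]
    ring
  · have hden := denom_pos k h _ (hγrange k (by omega) (by omega) _ ht)
    have e1 : ∑ n ∈ Finset.Ico 1 k, Gam ((n : ℝ) - (k : ℝ) / 2) * a n * a (k - n)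
        = p.1 ^ 2 * ∑ n ∈ Finset.Ico 1 k,
          Gam ((n : ℝ) - (k : ℝ) / 2) * cc γ N p n * cc γ N p (k - n) := by
      rw [Finset.mul_sum]
      refine Finset.sum_congr rfl fun n hn => ?_
      rw [Finset.mem_Ico] at hn
      rw [ha n (by omega), ha (k - n) (by omega)]; ring
    have e2 : ∑ m ∈ Finset.range (N + 1), Gam (((k : ℝ) + 1 + (m : ℝ)) - (k : ℝ) / 2)
          * a (k + 1 + m) * a (m + 1)
        = p.1 ^ 2 * ∑ m ∈ Finset.range (N + 1), Gam (((k : ℝ) + 1 + (m : ℝ)) - (k : ℝ) / 2)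
                  * cc γ N p (k + 1 + m) * cc γ N p (m + 1) := by
      rw [Finset.mul_sum]
      refine Finset.sum_congr rfl fun n hn => ?_
      rw [ha _ (by omega), ha (n + 1) (by omega)]; ring
    have hck : cc γ N p k = p.1 * yy N p k := by
      unfold cc dd; rw [if_neg (by omega), if_neg (by omega)]
    have hf : yy N p k * (1 - 2 * γ k (tt p) * Gam ((k : ℝ) / 2)) = γ k (tt p) * SS γ N k p := by
      rw [hfix k h (by omega)]
      unfold KK
      rw [if_neg (by omega), if_pos h, mul_right_comm, div_mul_cancel₀ _ hden.ne']
    rw [e1, e2, ha k hk, hck]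
    unfold SS at hf
    linear_combination p.1 ^ 2 * hf

theorem tt_contDiff (N : ℕ) : ContDiff ℝ 1 (tt (N := N)) := by
  unfold tt; fun_prop

theorem yy_contDiff (N k : ℕ) : ContDiff ℝ 1 (fun p => yy N p k) := by
  unfold yy
  split_ifs with h
  · fun_prop
  · fun_prop

theorem pi4_mem : Set.Icc (0 : ℝ) 1 ∈ 𝓝 (π / 4) :=
  Icc_mem_nhds (by have := Real.pi_pos; positivity) (by have := Real.pi_lt_four; linarith)

theorem gam_contDiffAt (N : ℕ) (γ : ℕ → ℝ → ℝ)
    (hγC2 : ∀ k, k ≤ N → ContDiffOn ℝ 2 (γ k) (Set.Icc 0 1)) (k : ℕ) (hk : k ≤ N) :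
    ContDiffAt ℝ 1 (γ k) (π / 4) :=
  ((hγC2 k hk).contDiffAt pi4_mem).of_le (by norm_num)

theorem gt_contDiffAt (N : ℕ) (γ : ℕ → ℝ → ℝ)
    (hγC2 : ∀ k, k ≤ N → ContDiffOn ℝ 2 (γ k) (Set.Icc 0 1)) (k : ℕ) (hk : k ≤ N)
    (x : Fin (N + 1) → ℝ) :
    ContDiffAt ℝ 1 (fun p : ℝ × (Fin (N + 1) → ℝ) => γ k (tt p)) (0, x) := by
  refine ContDiffAt.comp (g := γ k) (f := tt) _ ?_ (tt_contDiff N).contDiffAt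
  have : tt ((0 : ℝ), x) = π / 4 := by simp [tt]
  rw [this]; exact gam_contDiffAt N γ hγC2 k hk

theorem dd_contDiffAt (N : ℕ) (hN : 2 ≤ N) (γ : ℕ → ℝ → ℝ)
    (hγC2 : ∀ k, k ≤ N → ContDiffOn ℝ 2 (γ k) (Set.Icc 0 1)) (x : Fin (N + 1) → ℝ) (k : ℕ) : ContDiffAt ℝ 1 (fun p => dd γ N p k) (0, x) := by
  unfold dd
  split_ifs
  · exact (gt_contDiffAt N γ hγC2 2 hN x).mul ((yy_contDiff N 1).contDiffAt.pow 2)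
  · exact (yy_contDiff N k).contDiffAt

theorem cc_contDiffAt (N : ℕ) (hN : 2 ≤ N) (γ : ℕ → ℝ → ℝ)
    (hγC2 : ∀ k, k ≤ N → ContDiffOn ℝ 2 (γ k) (Set.Icc 0 1)) (x : Fin (N + 1) → ℝ) (k : ℕ) : ContDiffAt ℝ 1 (fun p => cc γ N p k) (0, x) := by
  unfold cc
  split_ifs
  · exact (yy_contDiff N 1).contDiffAt
  · exact contDiffAt_fst.mul (dd_contDiffAt N hN γ hγC2 x k)

theorem SS_contDiffAt (N : ℕ) (hN : 2 ≤ N) (γ : ℕ → ℝ → ℝ)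
    (hγC2 : ∀ k, k ≤ N → ContDiffOn ℝ 2 (γ k) (Set.Icc 0 1)) (x : Fin (N + 1) → ℝ) (k : ℕ) : ContDiffAt ℝ 1 (fun p => SS γ N k p) (0, x) := by
  unfold SS
  refine ContDiffAt.add ?_ (contDiffAt_const.mul ?_)
  · refine ContDiffAt.sum fun n _ => ?_
    exact (contDiffAt_const.mul (cc_contDiffAt N hN γ hγC2 x _)).mul (cc_contDiffAt N hN γ hγC2 x _)
  · refine ContDiffAt.sum fun n _ => ?_
    exact (contDiffAt_const.mul (cc_contDiffAt N hN γ hγC2 x _)).mul (cc_contDiffAt N hN γ hγC2 x _)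

theorem RR_contDiffAt (N : ℕ) (hN : 2 ≤ N) (γ : ℕ → ℝ → ℝ)
    (hγC2 : ∀ k, k ≤ N → ContDiffOn ℝ 2 (γ k) (Set.Icc 0 1)) (x : Fin (N + 1) → ℝ) : ContDiffAt ℝ 1 (fun p => RR γ N p) (0, x) := by
  unfold RR
  refine ContDiffAt.sum fun n _ => ?_
  exact (contDiffAt_const.mul (dd_contDiffAt N hN γ hγC2 x _)).mul (dd_contDiffAt N hN γ hγC2 x _)

theorem AA_contDiffAt (N : ℕ) (hN : 2 ≤ N) (γ : ℕ → ℝ → ℝ)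
    (hγC2 : ∀ k, k ≤ N → ContDiffOn ℝ 2 (γ k) (Set.Icc 0 1)) (x : Fin (N + 1) → ℝ) (h2 : 0 < γ 2 (π / 4)) :
    ContDiffAt ℝ 1 (fun p : ℝ × (Fin (N + 1) → ℝ) => 3 / (tt p * γ 2 (tt p))) (0, x) := by
  refine contDiffAt_const.div ((tt_contDiff N).contDiffAt.mul (gt_contDiffAt N γ hγC2 2 hN x)) ?_
  have : tt ((0 : ℝ), x) = π / 4 := by simp [tt]
  rw [this]
  have := Real.pi_pos
  positivity

theorem QQ_contDiffAt (N : ℕ) (hN : 2 ≤ N) (γ : ℕ → ℝ → ℝ)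
    (hγC2 : ∀ k, k ≤ N → ContDiffOn ℝ 2 (γ k) (Set.Icc 0 1)) (x : Fin (N + 1) → ℝ) (h2 : 0 < γ 2 (π / 4)) (hx : yy N (0, x) 1 ≠ 0) :
    ContDiffAt ℝ 1 (fun p => QQ γ N p) (0, x) := by
  unfold QQ
  refine (AA_contDiffAt N hN γ hγC2 x h2).mul (contDiffAt_const.add (contDiffAt_fst.mul ?_))
  refine ContDiffAt.div ?_ (yy_contDiff N 1).contDiffAt hx
  exact ((tt_contDiff N).contDiffAt.mul contDiffAt_const).mul (RR_contDiffAt N hN γ hγC2 x)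

theorem QQ_zero (N : ℕ) (γ : ℕ → ℝ → ℝ) (x : Fin (N + 1) → ℝ) : QQ γ N (0, x) = 12 / (π * γ 2 (π / 4)) := by
  have : tt ((0 : ℝ), x) = π / 4 := by simp [tt]
  unfold QQ
  rw [this, zero_mul, add_zero, mul_one, show π / 4 * γ 2 (π / 4) = (π * γ 2 (π / 4)) / 4 by ring,
    div_div_eq_mul_div]
  norm_num

theorem KK_contDiffAt (N : ℕ) (hN : 2 ≤ N) (γ : ℕ → ℝ → ℝ)
    (hγC2 : ∀ k, k ≤ N → ContDiffOn ℝ 2 (γ k) (Set.Icc 0 1)) (x : Fin (N + 1) → ℝ) (hγrange : ∀ k, 2 ≤ k → k ≤ N → ∀ s ∈ Set.Icc (0 : ℝ) 1, γ k s ∈ Set.Icc (-1 : ℝ) 1)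
    (h2 : 0 < γ 2 (π / 4)) (hx : yy N (0, x) 1 ≠ 0) (k : ℕ) (hk : k ≤ N) :
    ContDiffAt ℝ 1 (fun p => KK γ N k p) (0, x) := by
  unfold KK
  split_ifs with h1 h3
  · refine (QQ_contDiffAt N hN γ hγC2 x h2 hx).sqrt ?_
    rw [QQ_zero]
    have := Real.pi_pos
    positivity
  · refine ContDiffAt.mul (ContDiffAt.div (gt_contDiffAt N γ hγC2 k hk x) ?_ ?_)
      (SS_contDiffAt N hN γ hγC2 x k)
    · exact contDiffAt_const.sub ((contDiffAt_const.mul (gt_contDiffAt N γ hγC2 k hk x)).mul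
        contDiffAt_const)
    · have : tt ((0 : ℝ), x) = π / 4 := by simp [tt]
      rw [this]
      exact (denom_pos k h3 _ (hγrange k (by omega) hk _ (mem_of_mem_nhds pi4_mem))).ne'
  · exact contDiffAt_const

theorem KK_zero (N : ℕ) (γ : ℕ → ℝ → ℝ) (x : Fin (N + 1) → ℝ) (k : ℕ) :
    KK γ N k (0, x) = if k = 1 then Real.sqrt (12 / (π * γ 2 (π / 4))) else 0 := by
  unfold KK
  split_ifs with h1 h3
  · rw [QQ_zero]
  · have hc : ∀ n, 2 ≤ n → cc γ N (0, x) n = 0 := by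
      intro n hn
      unfold cc; rw [if_neg (by omega)]; simp
    have : SS γ N k (0, x) = 0 := by
      unfold SS
      rw [Finset.sum_eq_zero, Finset.sum_eq_zero]
      · simp
      · intro m _
        rw [hc (k + 1 + m) (by omega)]; simp
      · intro n hn
        rw [Finset.mem_Ico] at hn
        by_cases h : 2 ≤ n
        · rw [hc n h]; simp
        · rw [hc (k - n) (by omega)]; simp
    rw [this, mul_zero]
  · rfl


/-- Under the Hypothesis on the noise family `g_{γ₁}`, there is a
`γ_max > π/4` such that for `π/4 < γ₁ < γ_max` there exists a nonuniform stationary solution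
`(ā_k(γ₁))` of the Maxwellian Fourier dynamics with `ā₀ = 1`, `ā_k = 0` for `k > N`, and
`ā₁(γ₁) = √(12(γ₁ - π/4)/(π γ₂(π/4))) + O((γ₁ - π/4)^{3/2})`; in particular the bifurcation
has critical exponent `1/2`. -/
theorem stmt_13
    (N : ℕ) (hN : 2 ≤ N)
    (γ : ℕ → ℝ → ℝ)
    (hγ0 : ∀ s, γ 0 s = 1)
    (hγ1 : ∀ s, γ 1 s = s)
    (hγhigh : ∀ k, N < k → ∀ s, γ k s = 0)
    (hγC2 : ∀ k, k ≤ N → ContDiffOn ℝ 2 (γ k) (Set.Icc 0 1))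
    (hγrange : ∀ k, 2 ≤ k → k ≤ N → ∀ s ∈ Set.Icc (0 : ℝ) 1, γ k s ∈ Set.Icc (-1 : ℝ) 1)
    (hγ2pos : ∀ s ∈ Set.Icc (0 : ℝ) 1, 0 < γ 2 s) :
    ∃ γmax : ℝ, π / 4 < γmax ∧
      ∃ abar : ℝ → ℕ → ℝ, ∃ C : ℝ, 0 < C ∧
        ∀ γ₁ ∈ Set.Ioo (π / 4) γmax,
          abar γ₁ 0 = 1 ∧
          (∀ k : ℕ, N < k → abar γ₁ k = 0) ∧
          (∀ k : ℕ, 1 ≤ k →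
            abar γ₁ k = 2 * γ k γ₁ * Gam ((k : ℝ) / 2) * abar γ₁ k
              + γ k γ₁ * (∑ n ∈ Finset.Ico 1 k,
                  Gam ((n : ℝ) - (k : ℝ) / 2) * abar γ₁ n * abar γ₁ (k - n))
              + 2 * γ k γ₁ * (∑' m : ℕ, Gam (((k : ℝ) + 1 + (m : ℝ)) - (k : ℝ) / 2)
                  * abar γ₁ (k + 1 + m) * abar γ₁ (m + 1))) ∧
          |abar γ₁ 1 - Real.sqrt (12 * (γ₁ - π / 4) / (π * γ 2 (π / 4)))| ≤
            C * (γ₁ - π / 4) ^ ((3 : ℝ) / 2) := by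
  classical
  have hpi := Real.pi_pos
  have h2 : 0 < γ 2 (π / 4) := hγ2pos _ (mem_of_mem_nhds pi4_mem)
  set ρ0 : ℝ := Real.sqrt (12 / (π * γ 2 (π / 4))) with hρ0
  have hρ0pos : 0 < ρ0 := Real.sqrt_pos.mpr (by positivity)
  have hρ0sq : ρ0 ^ 2 = 12 / (π * γ 2 (π / 4)) := Real.sq_sqrt (by positivity)
  let x0 : Fin (N + 1) → ℝ := fun i => if (i : ℕ) = 1 then ρ0 else 0
  have hx0 : ∀ s k, yy N (s, x0) k = if k = 1 then ρ0 else 0 := by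
    intro s k
    unfold yy
    split_ifs with h h' h'
    · simp [x0, h']
    · simp [x0, h']
    · omega
    · rfl
  have hx1 : yy N (0, x0) 1 = ρ0 := by rw [hx0]; simp
  obtain ⟨X, hXd, hX0, hXfix⟩ := ift_fix
    (fun p : ℝ × (Fin (N + 1) → ℝ) => fun i : Fin (N + 1) => KK γ N i p) x0
    (contDiffAt_pi.mpr fun i => KK_contDiffAt N hN γ hγC2 x0 hγrange h2
      (by rw [hx1]; exact hρ0pos.ne') i (by omega))
    (by intro x; funext i; simp only [KK_zero]; rfl)
  have hpd : DifferentiableAt ℝ (fun s : ℝ => (s, X s)) 0 := differentiableAt_id.prodMk hXd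
  have hpd0 : (fun s : ℝ => (s, X s)) 0 = (0, x0) := by simp [hX0]
  -- components of the solution
  have hρd : DifferentiableAt ℝ (fun s : ℝ => yy N (s, X s) 1) 0 :=
    DifferentiableAt.comp (g := fun p => yy N p 1) (f := fun s : ℝ => (s, X s)) 0
      ((yy_contDiff N 1).differentiable (by norm_num) _) hpd
  have hρ00 : yy N (0, X 0) 1 = ρ0 := by rw [hX0, hx1]
  have hRd : DifferentiableAt ℝ (fun s : ℝ => RR γ N (s, X s)) 0 := by
    refine DifferentiableAt.comp (g := fun p => RR γ N p) (f := fun s : ℝ => (s, X s)) 0 ?_ hpd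
    rw [hX0]
    exact (RR_contDiffAt N hN γ hγC2 x0).differentiableAt (by norm_num)
  have hR0 : RR γ N (0, X 0) = 0 := by
    rw [hX0]
    unfold RR
    refine Finset.sum_eq_zero fun m _ => ?_
    have : dd γ N (0, x0) (m + 3) = 0 := by
      unfold dd
      rw [if_neg (by omega), hx0, if_neg (by omega)]
    rw [this]; ring
  have hRO : (fun s : ℝ => RR γ N (s, X s)) =O[𝓝 0] (fun s : ℝ => s) := by
    have := hRd.isBigO_sub
    simpa [hR0] using this
  -- the leading coefficient
  have hhd : DifferentiableAt ℝ (fun e : ℝ => 3 / ((π / 4 + e) * γ 2 (π / 4 + e))) 0 := by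
    have hg : DifferentiableAt ℝ (fun e : ℝ => γ 2 (π / 4 + e)) 0 := by
      refine DifferentiableAt.comp (g := γ 2) (f := fun e : ℝ => π / 4 + e) 0 ?_ (by fun_prop)
      rw [add_zero]
      exact (gam_contDiffAt N γ hγC2 2 hN).differentiableAt (by norm_num)
    refine (differentiableAt_const _).div (DifferentiableAt.mul (by fun_prop) hg) ?_
    rw [add_zero]; positivity
  have hh0 : 3 / (π / 4 * γ 2 (π / 4)) = ρ0 ^ 2 := by
    rw [hρ0sq]; field_simp; norm_num
  have hsq : Tendsto (fun s : ℝ => s ^ 2) (𝓝 0) (𝓝 0) := by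
    have : ContinuousAt (fun s : ℝ => s ^ 2) 0 := by fun_prop
    simpa [ContinuousAt] using this
  have hAO : (fun s : ℝ => 3 / ((π / 4 + s ^ 2) * γ 2 (π / 4 + s ^ 2)) - ρ0 ^ 2)
      =O[𝓝 0] (fun s : ℝ => s ^ 2) := by
    have := hhd.isBigO_sub.comp_tendsto hsq
    simpa [Function.comp_def, hh0] using this
  have hBc : ContinuousAt (fun s : ℝ => 3 / ((π / 4 + s ^ 2) * γ 2 (π / 4 + s ^ 2)) *
      ((π / 4 + s ^ 2) * (π / 2) / yy N (s, X s) 1)) 0 := by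
    refine ContinuousAt.mul ?_ (ContinuousAt.div (by fun_prop) hρd.continuousAt ?_)
    · refine ContinuousAt.comp (g := fun e : ℝ => 3 / ((π / 4 + e) * γ 2 (π / 4 + e)))
        (f := fun s : ℝ => s ^ 2) ?_ (by fun_prop)
      simpa using hhd.continuousAt
    · rw [hρ00]; exact hρ0pos.ne'
  have hQO : (fun s : ℝ => QQ γ N (s, X s) - ρ0 ^ 2) =O[𝓝 0] (fun s : ℝ => s ^ 2) := by
    have h1 := ((Asymptotics.isBigO_refl (fun s : ℝ => s) (𝓝 0)).mul hRO)
    have h3 := (hBc.tendsto.isBigO_one ℝ).mul h1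
    refine (hAO.add (h3.congr_right (g₂ := fun s : ℝ => s ^ 2) (by intro s; ring))).congr_left ?_
    intro s
    simp only [QQ, tt]
    ring
  have hρpos : ∀ᶠ s in 𝓝 (0 : ℝ), 0 < yy N (s, X s) 1 :=
    hρd.continuousAt.eventually (lt_mem_nhds (by simp only [hρ00]; exact hρ0pos))
  have hfixk : ∀ᶠ s in 𝓝 (0 : ℝ), ∀ k, k ≤ N → yy N (s, X s) k = KK γ N k (s, X s) := by
    filter_upwards [hXfix] with s hs k hk
    have e := congrFun hs ⟨k, by omega⟩
    unfold yy
    rw [dif_pos (by omega)]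
    exact e
  have hρQ : ∀ᶠ s in 𝓝 (0 : ℝ), yy N (s, X s) 1 ^ 2 = QQ γ N (s, X s) := by
    filter_upwards [hρpos, hfixk] with s h1 h3
    have e : yy N (s, X s) 1 = Real.sqrt (QQ γ N (s, X s)) := by
      rw [h3 1 (by omega)]; simp [KK]
    rw [e] at h1 ⊢
    exact Real.sq_sqrt (Real.sqrt_pos.mp h1).le
  obtain ⟨C, hC, hCO⟩ := hQO.exists_pos
  rw [Asymptotics.isBigOWith_iff] at hCO
  have htm : ∀ᶠ s in 𝓝 (0 : ℝ), π / 4 + s ^ 2 ∈ Set.Icc (0 : ℝ) 1 := by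
    have : Tendsto (fun s : ℝ => π / 4 + s ^ 2) (𝓝 0) (𝓝 (π / 4)) := by
      simpa using hsq.const_add (π / 4)
    exact this.eventually pi4_mem
  obtain ⟨δ, hδ, hall⟩ := Metric.eventually_nhds_iff.mp
    (hρpos.and (hfixk.and (hρQ.and (hCO.and htm))))
  refine ⟨π / 4 + δ ^ 2, by linarith [pow_pos hδ 2], fun g k => if k = 0 then 1 else
    Real.sqrt (g - π / 4) * cc γ N (Real.sqrt (g - π / 4), X (Real.sqrt (g - π / 4))) k,
    C / ρ0, by positivity, ?_⟩
  intro g hg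
  have hε : 0 < g - π / 4 := by linarith [hg.1]
  set s := Real.sqrt (g - π / 4) with hs
  have hspos : 0 < s := Real.sqrt_pos.mpr hε
  have hs2 : s ^ 2 = g - π / 4 := Real.sq_sqrt hε.le
  have hsδ : s < δ := by
    rw [hs, Real.sqrt_lt' hδ]; linarith [hg.2]
  obtain ⟨p1, p2, p3, p4, p5⟩ := hall (y := s) (by
    rw [Real.dist_eq, sub_zero, abs_of_pos hspos]; exact hsδ)
  have htt : tt (s, X s) = g := by simp only [tt]; linarith
  refine ⟨by simp, ?_, ?_, ?_⟩
  · intro k hk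
    simp only
    rw [if_neg (by omega), cc_high γ N hN _ k hk, mul_zero]
  · intro k hk
    have := stationary N hN γ hγ1 hγhigh hγrange hγ2pos (s, X s) p5 p1 p3
      (fun k _ hk => p2 k hk) (fun k => if k = 0 then 1 else s * cc γ N (s, X s) k)
      (fun k hk => by simp only; rw [if_neg (by omega)]) k hk
    rw [htt] at this
    exact this
  · have e1 : Real.sqrt (12 * (g - π / 4) / (π * γ 2 (π / 4))) = s * ρ0 := by
      rw [hs, hρ0, ← Real.sqrt_mul hε.le]; congr 1; ring
    have e2 : (g - π / 4) ^ ((3 : ℝ) / 2) = s ^ 3 := by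
      rw [← hs2, ← Real.rpow_natCast s 2, ← Real.rpow_mul hspos.le, ← Real.rpow_natCast s 3]
      norm_num
    have e3 : cc γ N (s, X s) 1 = yy N (s, X s) 1 := by simp [cc]
    simp only [one_ne_zero, if_false]
    rw [e1, e2, e3, ← mul_sub, abs_mul, abs_of_pos hspos]
    rw [← p3, Real.norm_eq_abs, Real.norm_eq_abs, abs_of_nonneg (sq_nonneg s), sq_sub_sq, abs_mul,
      abs_of_pos (by positivity)] at p4
    generalize yy N (s, X s) 1 = ρ at *
    have h5 : ρ0 * |ρ - ρ0| ≤ C * s ^ 2 :=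
      le_trans (mul_le_mul_of_nonneg_right (by linarith) (abs_nonneg _)) p4
    have h6 : |ρ - ρ0| ≤ C * s ^ 2 / ρ0 := by
      rw [le_div_iff₀ hρ0pos]; linarith
    calc s * |ρ - ρ0| ≤ s * (C * s ^ 2 / ρ0) := mul_le_mul_of_nonneg_left h6 hspos.le
      _ = C / ρ0 * s ^ 3 := by ring
end
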